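/- arXiv:1506.05918 — 3 statements merged into one kernel-verified Lean document; each statement's English description precedes it below -/
import Mathlib

section
/- (Failure of Sussmann's condition.) Let Assumption A hold. Then [F1,[F0,F1]](O) = 0, and if moreover M1 + M2 ≠ 0, then the 'bad bracket' value [F2,[F0,F2]](O) does not lie in the linear span of X3(O) and X4(O), where O = (0,0,0,0). -/
open Real Matrix Set

/-- The 4×4 matrix E(α) of the two-link magneto-elastic swimmer,
with blocks E11, E12, E21, E22 as in the paper. -/
noncomputable def Emat (l1 l2 x1 x2 e1 e2 a : ℝ) : Matrix (Fin 4) (Fin 4) ℝ :=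
  !![ -(x1*l1 + x2*l2) * Real.cos a, -(x1*l1 + e2*l2) * Real.sin a,
        (1/2)*x1*l1*l2*Real.sin a, 0;
      (e1*l1 + x2*l2) * Real.sin a, -(e1*l1 + e2*l2) * Real.cos a,
        (1/2)*e1*l1*(l1 + l2*Real.cos a), (1/2)*e1*l1^2;
      (1/2)*(e1*l1^2*(-Real.sin a)), (1/2)*(e1*l1^2*Real.cos a - e2*l2^2),
        -(e1*l1^2*((1/4)*l2*Real.cos a + (1/3)*l1) + e2*l2^2*((1/12)*l2)),
        -(e1*l1^2*((1/3)*l1));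
      0, (1/2)*(-(e2*l2^2)), -(e2*l2^2*((1/12)*l2)), 0]

/-- R̃(θ) = diag(R_θ, I₂). -/
noncomputable def Rtil (th : ℝ) : Matrix (Fin 4) (Fin 4) ℝ :=
  !![Real.cos th, -Real.sin th, 0, 0;
     Real.sin th,  Real.cos th, 0, 0;
     0, 0, 1, 0;
     0, 0, 0, 1]

/-- X3(z) = R̃(θ)·(third column of E(α)⁻¹), where z = (x,y,θ,α). -/
noncomputable def X3 (l1 l2 x1 x2 e1 e2 : ℝ) (z : Fin 4 → ℝ) : Fin 4 → ℝ :=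
  (Rtil (z 2)).mulVec fun i => (Emat l1 l2 x1 x2 e1 e2 (z 3))⁻¹ i 2

/-- X4(z) = R̃(θ)·(fourth column of E(α)⁻¹), where z = (x,y,θ,α). -/
noncomputable def X4 (l1 l2 x1 x2 e1 e2 : ℝ) (z : Fin 4 → ℝ) : Fin 4 → ℝ :=
  (Rtil (z 2)).mulVec fun i => (Emat l1 l2 x1 x2 e1 e2 (z 3))⁻¹ i 3

/-- F0(z) = κ α X4(z). -/
noncomputable def F0 (l1 l2 x1 x2 e1 e2 k : ℝ) (z : Fin 4 → ℝ) : Fin 4 → ℝ :=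
  (k * z 3) • X4 l1 l2 x1 x2 e1 e2 z

/-- F1(z) = M1 sin α · X3(z). -/
noncomputable def F1 (l1 l2 x1 x2 e1 e2 M1 : ℝ) (z : Fin 4 → ℝ) : Fin 4 → ℝ :=
  (M1 * Real.sin (z 3)) • X3 l1 l2 x1 x2 e1 e2 z

/-- F2(z) = −(M1 cos α + M2) X3(z) − M2 X4(z). -/
noncomputable def F2 (l1 l2 x1 x2 e1 e2 M1 M2 : ℝ) (z : Fin 4 → ℝ) : Fin 4 → ℝ :=
  (-(M1 * Real.cos (z 3) + M2)) • X3 l1 l2 x1 x2 e1 e2 z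
    - M2 • X4 l1 l2 x1 x2 e1 e2 z

/-- Lie bracket of two vector fields on ℝ⁴: [X,Y](z) = DY(z)·X(z) − DX(z)·Y(z). -/
noncomputable def lieBr (X Y : (Fin 4 → ℝ) → (Fin 4 → ℝ)) (z : Fin 4 → ℝ) : Fin 4 → ℝ :=
  fderiv ℝ Y z (X z) - fderiv ℝ X z (Y z)

/-- The origin O = (0,0,0,0). -/
def Ovec : Fin 4 → ℝ := ![0, 0, 0, 0]

/-- Assumption A of the paper. -/
def AssumptionA (l1 l2 x1 x2 e1 e2 M1 M2 : ℝ) : Prop :=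
  ((e1 - x1, e2 - x2) ≠ (0, 0)) ∧ x1 ≤ e1 ∧ x2 ≤ e2 ∧ M1 ≠ 0 ∧ M2 ≠ 0 ∧
    (3 + 4*(l2/l1) + e2*l2^2/(e1*l1^2)) * M1
      - (3 + 4*(l1/l2) + e1*l1^2/(e2*l2^2)) * M2 ≠ 0

open Filter Topology VectorField

section BadBracket

variable {E : Type*} [NormedAddCommGroup E] [NormedSpace ℝ E]

/-- If `f` vanishes at `x`, then `[W, [f V, W]]` equals `2 (W f) [V, W]` at `x`,
up to a multiple of `V x`. -/
theorem lieBracket_lieBracket_smul_of_eq_zero {f : E → ℝ} {V W : E → E} {x : E}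
    (hf : ContDiffAt ℝ 2 f x) (hV : ContDiffAt ℝ 2 V x) (hW : ContDiffAt ℝ 2 W x)
    (hfx : f x = 0) :
    lieBracket ℝ W (lieBracket ℝ (fun y => f y • V y) W) x =
      (2 * fderiv ℝ f x (W x)) • lieBracket ℝ V W x
        - fderiv ℝ (fun y => fderiv ℝ f y (W y)) x (W x) • V x := by
  have hloc : lieBracket ℝ (fun y => f y • V y) W =ᶠ[𝓝 x]
      (fun y => (-fderiv ℝ f y (W y)) • V y) + fun y => f y • lieBracket ℝ V W y := by
    filter_upwards [hf.eventually (by simp), hV.eventually (by simp)] with y hfy hVy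
    simpa using lieBracket_smul_left (W := W) (hfy.differentiableAt (by simp))
      (hVy.differentiableAt (by simp))
  have hWf : DifferentiableAt ℝ (fun y => fderiv ℝ f y (W y)) x :=
    ((hf.fderiv_right (m := 1) (by norm_num)).clm_apply
      (hW.of_le (by norm_num))).differentiableAt (by simp)
  have hVW : DifferentiableAt ℝ (lieBracket ℝ V W) x :=
    (hV.lieBracket_vectorField hW (m := 1) (by norm_num)).differentiableAt (by simp)
  have hf1 := hf.differentiableAt (by simp)
  have hV1 := hV.differentiableAt (by simp)
  rw [(EventuallyEq.refl _ W).lieBracket_vectorField_eq hloc,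
    lieBracket_add_right (hWf.fun_neg.fun_smul hV1) (hf1.fun_smul hVW),
    lieBracket_smul_right hWf.fun_neg hV1, lieBracket_smul_right hf1 hVW, hfx,
    lieBracket_swap (V := W) (W := V), fderiv_fun_neg]
  simp only [_root_.neg_apply, zero_smul, smul_neg, neg_smul, neg_neg]
  module

end BadBracket

section MatrixSmooth

variable {E ι : Type*} [NormedAddCommGroup E] [NormedSpace ℝ E] [Fintype ι] [DecidableEq ι]
  {n : WithTop ℕ∞} {A : E → Matrix ι ι ℝ} {x : E}

theorem contDiffAt_matrix_det (hA : ∀ i j, ContDiffAt ℝ n (fun y => A y i j) x) :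
    ContDiffAt ℝ n (fun y => (A y).det) x := by
  simp only [Matrix.det_apply]
  exact ContDiffAt.sum fun σ _ => (contDiffAt_prod fun i _ => hA _ _).const_smul _

theorem contDiffAt_matrix_inv (hA : ∀ i j, ContDiffAt ℝ n (fun y => A y i j) x)
    (hdet : (A x).det ≠ 0) (i j : ι) : ContDiffAt ℝ n (fun y => (A y)⁻¹ i j) x := by
  simp only [Matrix.inv_def, Matrix.smul_apply, Ring.inverse_eq_inv', smul_eq_mul,
    Matrix.adjugate_apply]
  refine ((contDiffAt_matrix_det hA).inv hdet).mul (contDiffAt_matrix_det fun k l => ?_)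
  by_cases hk : k = j
  · simpa [hk] using contDiffAt_const
  · simpa [Matrix.updateRow_ne hk] using hA k l

end MatrixSmooth

section RotatedFields

/-- The vector field `z ↦ R̃(θ) c(α)` generated by a curve `c` of velocities in the body frame. -/
noncomputable def rotField (c : ℝ → Fin 4 → ℝ) (z : Fin 4 → ℝ) : Fin 4 → ℝ :=
  Rtil (z 2) *ᵥ c (z 3)

theorem rotField_apply_zero (c : ℝ → Fin 4 → ℝ) (z : Fin 4 → ℝ) :
    rotField c z 0 = Real.cos (z 2) * c (z 3) 0 - Real.sin (z 2) * c (z 3) 1 := by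
  simp [rotField, Rtil, mulVec, dotProduct, Fin.sum_univ_four]
  ring

theorem rotField_Ovec (c : ℝ → Fin 4 → ℝ) : rotField c Ovec = c 0 := by
  ext i
  fin_cases i <;> simp [rotField, Rtil, Ovec, mulVec, dotProduct, Fin.sum_univ_four]

theorem contDiffAt_rotField {n : WithTop ℕ∞} {c : ℝ → Fin 4 → ℝ} {z : Fin 4 → ℝ}
    (hc : ContDiffAt ℝ n c (z 3)) : ContDiffAt ℝ n (rotField c) z := by
  have hc' : ∀ i, ContDiffAt ℝ n (fun y : Fin 4 → ℝ => c (y 3) i) z := fun i =>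
    (contDiffAt_pi.1 hc i).comp z (contDiff_apply ℝ ℝ (3 : Fin 4)).contDiffAt
  have hθ : ContDiffAt ℝ n (fun y : Fin 4 → ℝ => y 2) z :=
    (contDiff_apply ℝ ℝ (2 : Fin 4)).contDiffAt
  refine contDiffAt_pi.2 fun i => ?_
  simp only [rotField, mulVec, dotProduct]
  refine ContDiffAt.sum fun j _ => ContDiffAt.mul ?_ (hc' j)
  fin_cases i <;> fin_cases j <;> simp [Rtil] <;>
    first
    | exact contDiffAt_const
    | exact hθ.cos
    | exact hθ.sin
    | exact hθ.sin.neg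

theorem fderiv_rotField_Ovec_apply_zero {c : ℝ → Fin 4 → ℝ} {c' : ℝ}
    (hc : ContDiffAt ℝ 1 c 0) (hc' : HasDerivAt (fun a => c a 0) c' 0) (v : Fin 4 → ℝ) :
    fderiv ℝ (rotField c) Ovec v 0 = c' * v 3 - c 0 1 * v 2 := by
  have hpath : HasDerivAt (fun t : ℝ => t • v) v 0 := by
    simpa using (hasDerivAt_id (0 : ℝ)).smul_const v
  have hO : (0 : ℝ) • v = Ovec := by
    ext i; fin_cases i <;> simp [Ovec]
  have hfd : HasFDerivAt (rotField c) (fderiv ℝ (rotField c) Ovec) ((0 : ℝ) • v) :=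
    hO.symm ▸ ((contDiffAt_rotField (z := Ovec) hc).differentiableAt (by simp)).hasFDerivAt
  have hcomp := hasDerivAt_pi.1 (hfd.comp_hasDerivAt (0 : ℝ) hpath) 0
  simp only [Function.comp_apply, rotField_apply_zero, Pi.smul_apply, smul_eq_mul] at hcomp
  have hlin : ∀ w : ℝ, HasDerivAt (fun t : ℝ => t * w) w 0 := fun w => by
    simpa using (hasDerivAt_id (0 : ℝ)).mul_const w
  have h0 : HasDerivAt (fun t => c (t * v 3) 0) (c' * v 3) 0 :=
    HasDerivAt.comp (0 : ℝ) (h₂ := fun a => c a 0) (by simpa using hc') (hlin (v 3))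
  have h1 : HasDerivAt (fun t => c (t * v 3) 1) (deriv (fun a => c a 1) 0 * v 3) 0 :=
    HasDerivAt.comp (0 : ℝ) (h₂ := fun a => c a 1)
      (by simpa using (differentiableAt_pi.1 (hc.differentiableAt (by simp)) 1).hasDerivAt)
      (hlin (v 3))
  have hexp := ((hlin (v 2)).cos.mul h0).sub ((hlin (v 2)).sin.mul h1)
  rw [hcomp.unique hexp]
  simp
  ring

theorem lieBracket_rotField_Ovec_apply_zero {c d : ℝ → Fin 4 → ℝ} {c' d' : ℝ}
    (hc : ContDiffAt ℝ 1 c 0) (hc' : HasDerivAt (fun a => c a 0) c' 0)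
    (hd : ContDiffAt ℝ 1 d 0) (hd' : HasDerivAt (fun a => d a 0) d' 0) :
    lieBracket ℝ (rotField c) (rotField d) Ovec 0 =
      d' * c 0 3 - d 0 1 * c 0 2 - (c' * d 0 3 - c 0 1 * d 0 2) := by
  simp only [lieBracket, Pi.sub_apply, fderiv_rotField_Ovec_apply_zero hc hc',
    fderiv_rotField_Ovec_apply_zero hd hd', rotField_Ovec]

end RotatedFields

section Resistance

variable {l1 l2 x1 x2 e1 e2 : ℝ}

theorem det_Emat_zero : (Emat l1 l2 x1 x2 e1 e2 0).det =
    -((x1 * l1 + x2 * l2) * (e1 * l1 * (e2 * l2) * (e1 * l1 + e2 * l2) * l1 ^ 2 * l2 ^ 2 / 36)) := by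
  simp [Emat, det_succ_row_zero, Fin.sum_univ_succ, Fin.succAbove]
  ring

theorem contDiff_Emat {n : WithTop ℕ∞} (i j : Fin 4) :
    ContDiff ℝ n fun a => Emat l1 l2 x1 x2 e1 e2 a i j := by
  have hs : ContDiff ℝ n Real.sin := Real.contDiff_sin
  have hc : ContDiff ℝ n Real.cos := Real.contDiff_cos
  fin_cases i <;> fin_cases j <;> simp [Emat] <;> fun_prop

theorem contDiffAt_Emat_inv_col {n : WithTop ℕ∞} (hdet : (Emat l1 l2 x1 x2 e1 e2 0).det ≠ 0)
    (j : Fin 4) : ContDiffAt ℝ n (fun a i => (Emat l1 l2 x1 x2 e1 e2 a)⁻¹ i j) 0 :=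
  contDiffAt_pi.2 fun i => contDiffAt_matrix_inv (fun k l => (contDiff_Emat k l).contDiffAt) hdet i j

theorem det_mul_Emat_inv (hdet : (Emat l1 l2 x1 x2 e1 e2 0).det ≠ 0) (i j : Fin 4) :
    (Emat l1 l2 x1 x2 e1 e2 0).det * (Emat l1 l2 x1 x2 e1 e2 0)⁻¹ i j =
      (Emat l1 l2 x1 x2 e1 e2 0).adjugate i j := by
  rw [inv_def, Matrix.smul_apply, Ring.inverse_eq_inv', smul_eq_mul, mul_inv_cancel_left₀ hdet]

theorem adjugate_Emat_zero_col_two (i : Fin 4) :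
    (Emat l1 l2 x1 x2 e1 e2 0).adjugate i 2 = (x1 * l1 + x2 * l2) * (![0,
      e1 * l1 * (e2 * l2) * l1 * l2 ^ 2 / 24,
      -(e1 * l1 * (e2 * l2) * l1 * l2 / 4),
      e1 * l1 * (e2 * l2) * (l2 ^ 2 / 3 + l1 * l2 / 4) + (e2 * l2) ^ 2 * l2 ^ 2 / 12] :
        Fin 4 → ℝ) i := by
  rw [adjugate_apply]
  fin_cases i <;>
    simp [Emat, det_succ_row_zero, Fin.sum_univ_succ, Fin.succAbove, updateRow_apply] <;> ring

theorem adjugate_Emat_zero_col_three (i : Fin 4) :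
    (Emat l1 l2 x1 x2 e1 e2 0).adjugate i 3 = (x1 * l1 + x2 * l2) * (![0,
      (e1 * l1) ^ 2 * l1 ^ 2 * l2 / 24 - e1 * l1 * (e2 * l2) * l1 * l2 ^ 2 / 24,
      (e1 * l1) ^ 2 * l1 ^ 2 / 12 + e1 * l1 * (e2 * l2) * (l1 ^ 2 / 3 + l1 * l2 / 4),
      -((e1 * l1) ^ 2 * l1 ^ 2 / 12
        + e1 * l1 * (e2 * l2) * (l1 ^ 2 / 3 + l1 * l2 / 2 + l2 ^ 2 / 3)
        + (e2 * l2) ^ 2 * l2 ^ 2 / 12)] : Fin 4 → ℝ) i := by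
  rw [adjugate_apply]
  fin_cases i <;>
    simp [Emat, det_succ_row_zero, Fin.sum_univ_succ, Fin.succAbove, updateRow_apply] <;> ring

/-- Derivative at straight shape of the longitudinal velocity, read off from
the first row of `E(α) E(α)⁻¹ = 1`. -/
theorem hasDerivAt_Emat_inv_zero (hl1 : 0 < l1) (hl2 : 0 < l2) (hx1 : 0 < x1) (hx2 : 0 < x2)
    (hdet : (Emat l1 l2 x1 x2 e1 e2 0).det ≠ 0) {j : Fin 4} (hj : j ≠ 0) :
    HasDerivAt (fun a => (Emat l1 l2 x1 x2 e1 e2 a)⁻¹ 0 j)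
      ((-(x1 * l1 + e2 * l2) * (Emat l1 l2 x1 x2 e1 e2 0)⁻¹ 1 j
        + x1 * l1 * l2 / 2 * (Emat l1 l2 x1 x2 e1 e2 0)⁻¹ 2 j) / (x1 * l1 + x2 * l2)) 0 := by
  have hS : x1 * l1 + x2 * l2 ≠ 0 := by positivity
  have hd : ∀ i, HasDerivAt (fun a => (Emat l1 l2 x1 x2 e1 e2 a)⁻¹ i j)
      (deriv (fun a => (Emat l1 l2 x1 x2 e1 e2 a)⁻¹ i j) 0) 0 := fun i =>
    (differentiableAt_pi.1 ((contDiffAt_Emat_inv_col (n := 1) hdet j).differentiableAt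
      (by simp)) i).hasDerivAt
  have hrow : (fun a => -(x1 * l1 + x2 * l2) * Real.cos a * (Emat l1 l2 x1 x2 e1 e2 a)⁻¹ 0 j
      - (x1 * l1 + e2 * l2) * Real.sin a * (Emat l1 l2 x1 x2 e1 e2 a)⁻¹ 1 j
      + x1 * l1 * l2 / 2 * Real.sin a * (Emat l1 l2 x1 x2 e1 e2 a)⁻¹ 2 j) =ᶠ[𝓝 0]
      fun _ => (0 : ℝ) := by
    have hcont : ContinuousAt (fun a => (Emat l1 l2 x1 x2 e1 e2 a).det) 0 :=
      (contDiffAt_matrix_det (n := 0) fun k l => (contDiff_Emat k l).contDiffAt).continuousAt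
    filter_upwards [hcont.eventually_ne hdet] with a ha
    have h := congr_fun₂ (mul_nonsing_inv _ (isUnit_iff_ne_zero.2 ha)) 0 j
    rw [one_apply_ne hj.symm, mul_apply, Fin.sum_univ_four] at h
    have h0 : Emat l1 l2 x1 x2 e1 e2 a 0 0 = -(x1 * l1 + x2 * l2) * Real.cos a := by simp [Emat]
    have h1 : Emat l1 l2 x1 x2 e1 e2 a 0 1 = -(x1 * l1 + e2 * l2) * Real.sin a := by simp [Emat]
    have h2 : Emat l1 l2 x1 x2 e1 e2 a 0 2 = 1 / 2 * x1 * l1 * l2 * Real.sin a := by simp [Emat]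
    have h3 : Emat l1 l2 x1 x2 e1 e2 a 0 3 = 0 := by simp [Emat]
    rw [h0, h1, h2, h3] at h
    linear_combination h
  have hlhs := ((((Real.hasDerivAt_cos 0).const_mul (-(x1 * l1 + x2 * l2))).mul (hd 0)).sub
    (((Real.hasDerivAt_sin 0).const_mul (x1 * l1 + e2 * l2)).mul (hd 1))).add
    (((Real.hasDerivAt_sin 0).const_mul (x1 * l1 * l2 / 2)).mul (hd 2))
  have heq := hlhs.unique ((hasDerivAt_const (0 : ℝ) (0 : ℝ)).congr_of_eventuallyEq hrow)
  convert hd 0 using 1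
  rw [div_eq_iff hS]
  simp at heq
  linear_combination heq

theorem det_Emat_zero_ne_zero (hl1 : 0 < l1) (hl2 : 0 < l2) (hx1 : 0 < x1) (hx2 : 0 < x2)
    (he1 : 0 < e1) (he2 : 0 < e2) : (Emat l1 l2 x1 x2 e1 e2 0).det ≠ 0 := by
  rw [det_Emat_zero]
  exact neg_ne_zero.2 (by positivity)

theorem X3_eq_rotField : X3 l1 l2 x1 x2 e1 e2 =
    rotField fun a i => (Emat l1 l2 x1 x2 e1 e2 a)⁻¹ i 2 := rfl

theorem X4_eq_rotField : X4 l1 l2 x1 x2 e1 e2 =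
    rotField fun a i => (Emat l1 l2 x1 x2 e1 e2 a)⁻¹ i 3 := rfl

theorem contDiffAt_X3 {n : WithTop ℕ∞} (hdet : (Emat l1 l2 x1 x2 e1 e2 0).det ≠ 0) :
    ContDiffAt ℝ n (X3 l1 l2 x1 x2 e1 e2) Ovec :=
  contDiffAt_rotField (z := Ovec) (contDiffAt_Emat_inv_col hdet 2)

theorem contDiffAt_X4 {n : WithTop ℕ∞} (hdet : (Emat l1 l2 x1 x2 e1 e2 0).det ≠ 0) :
    ContDiffAt ℝ n (X4 l1 l2 x1 x2 e1 e2) Ovec :=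
  contDiffAt_rotField (z := Ovec) (contDiffAt_Emat_inv_col hdet 3)

theorem X3_Ovec_apply_zero (hdet : (Emat l1 l2 x1 x2 e1 e2 0).det ≠ 0) :
    X3 l1 l2 x1 x2 e1 e2 Ovec 0 = 0 := by
  have h := det_mul_Emat_inv hdet 0 2
  rw [adjugate_Emat_zero_col_two] at h
  simpa [X3_eq_rotField, rotField_Ovec, hdet] using h

theorem X4_Ovec_apply_zero (hdet : (Emat l1 l2 x1 x2 e1 e2 0).det ≠ 0) :
    X4 l1 l2 x1 x2 e1 e2 Ovec 0 = 0 := by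
  have h := det_mul_Emat_inv hdet 0 3
  rw [adjugate_Emat_zero_col_three] at h
  simpa [X4_eq_rotField, rotField_Ovec, hdet] using h

theorem lieBracket_X4_X3_Ovec_apply_zero_ne_zero (hl1 : 0 < l1) (hl2 : 0 < l2) (hx1 : 0 < x1)
    (hx2 : 0 < x2) (he1 : 0 < e1) (he2 : 0 < e2) (h1 : x1 ≤ e1) (h2 : x2 ≤ e2)
    (hne : (e1 - x1, e2 - x2) ≠ (0, 0)) :
    lieBracket ℝ (X4 l1 l2 x1 x2 e1 e2) (X3 l1 l2 x1 x2 e1 e2) Ovec 0 ≠ 0 := by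
  have hdet := det_Emat_zero_ne_zero hl1 hl2 hx1 hx2 he1 he2
  rw [X4_eq_rotField, X3_eq_rotField, lieBracket_rotField_Ovec_apply_zero
    (contDiffAt_Emat_inv_col hdet 3) (hasDerivAt_Emat_inv_zero hl1 hl2 hx1 hx2 hdet (by decide))
    (contDiffAt_Emat_inv_col hdet 2) (hasDerivAt_Emat_inv_zero hl1 hl2 hx1 hx2 hdet (by decide))]
  have hP : ∀ i j, (Emat l1 l2 x1 x2 e1 e2 0)⁻¹ i j =
      (Emat l1 l2 x1 x2 e1 e2 0).adjugate i j / (Emat l1 l2 x1 x2 e1 e2 0).det := fun i j =>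
    eq_div_of_mul_eq hdet (by rw [mul_comm, det_mul_Emat_inv hdet])
  simp only [hP, adjugate_Emat_zero_col_two, adjugate_Emat_zero_col_three]
  have haniso : 0 < l1 * e1 * (e2 - x2) + l2 * e2 * (e1 - x1) := by
    rcases h1.lt_or_eq with h | h
    · have := mul_pos (mul_pos hl2 he2) (sub_pos.2 h)
      have := mul_nonneg (mul_pos hl1 he1).le (sub_nonneg.2 h2)
      linarith
    · have h2' : x2 < e2 := h2.lt_of_ne fun h' => hne (by simp [h, h'])
      have := mul_pos (mul_pos hl1 he1) (sub_pos.2 h2')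
      simpa [h] using this
  have hS : 0 < x1 * l1 + x2 * l2 := by positivity
  refine ne_of_eq_of_ne (b := (x1 * l1 + x2 * l2)
    * (e1 * l1 * (e2 * l2) * (e1 * l1 + e2 * l2) * l1 ^ 2 * l2 ^ 2 / 36)
    * (l1 * l2 / 2 * (l1 * e1 * (e2 - x2) + l2 * e2 * (e1 - x1)))
    / (Emat l1 l2 x1 x2 e1 e2 0).det ^ 2) ?_ (by positivity)
  generalize (Emat l1 l2 x1 x2 e1 e2 0).det = Δ at *
  simp
  field_simp
  ring

theorem F2_Ovec_apply_three_ne_zero {M1 M2 : ℝ} (hl1 : 0 < l1) (hl2 : 0 < l2) (hx1 : 0 < x1)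
    (hx2 : 0 < x2) (he1 : 0 < e1) (he2 : 0 < e2)
    (hM : (3 + 4*(l2/l1) + e2*l2^2/(e1*l1^2)) * M1
      - (3 + 4*(l1/l2) + e1*l1^2/(e2*l2^2)) * M2 ≠ 0) :
    F2 l1 l2 x1 x2 e1 e2 M1 M2 Ovec 3 ≠ 0 := by
  have hdet := det_Emat_zero_ne_zero hl1 hl2 hx1 hx2 he1 he2
  have h2 := det_mul_Emat_inv hdet 3 2
  have h3 := det_mul_Emat_inv hdet 3 3
  rw [adjugate_Emat_zero_col_two] at h2
  rw [adjugate_Emat_zero_col_three] at h3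
  have hS : 0 < x1 * l1 + x2 * l2 := by positivity
  refine fun h => hM ?_
  have hF : -(M1 + M2) * (Emat l1 l2 x1 x2 e1 e2 0)⁻¹ 3 2
      - M2 * (Emat l1 l2 x1 x2 e1 e2 0)⁻¹ 3 3 = 0 := by
    simpa [F2, X3_eq_rotField, X4_eq_rotField, rotField_Ovec, show Ovec 3 = 0 from rfl] using h
  simp at h2 h3
  have hzero : (x1 * l1 + x2 * l2) * ((e1 * l1 * (e2 * l2) * l1 * l2 / 12)
      * ((3 + 4*(l2/l1) + e2*l2^2/(e1*l1^2)) * M1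
        - (3 + 4*(l1/l2) + e1*l1^2/(e2*l2^2)) * M2)) = 0 := by
    field_simp
    linear_combination 12 * (-(Emat l1 l2 x1 x2 e1 e2 0).det * hF - (M1 + M2) * h2 - M2 * h3)
  have hab : e1 * l1 * (e2 * l2) * l1 * l2 / 12 ≠ 0 := by positivity
  simpa only [mul_eq_zero, hS.ne', hab, false_or] using hzero

end Resistance

/-- Modulo `X3` and `X4`, the bracket `[X4, F2]` at the origin is a multiple of `[X4, X3]`. -/
theorem lieBracket_X4_F2_Ovec_apply_zero {l1 l2 x1 x2 e1 e2 : ℝ}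
    (hdet : (Emat l1 l2 x1 x2 e1 e2 0).det ≠ 0) (M1 M2 : ℝ) :
    lieBracket ℝ (X4 l1 l2 x1 x2 e1 e2) (F2 l1 l2 x1 x2 e1 e2 M1 M2) Ovec 0 =
      -(M1 + M2) * lieBracket ℝ (X4 l1 l2 x1 x2 e1 e2) (X3 l1 l2 x1 x2 e1 e2) Ovec 0 := by
  have hF2 : F2 l1 l2 x1 x2 e1 e2 M1 M2 =
      (fun z => (-(M1 * Real.cos (z 3) + M2)) • X3 l1 l2 x1 x2 e1 e2 z)
        + (-M2) • X4 l1 l2 x1 x2 e1 e2 := by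
    ext z
    simp [F2, sub_eq_add_neg]
  have h3 := (contDiffAt_X3 (n := 1) hdet).differentiableAt (by simp)
  have h4 := (contDiffAt_X4 (n := 1) hdet).differentiableAt (by simp)
  have ha : DifferentiableAt ℝ (fun z : Fin 4 → ℝ => -(M1 * Real.cos (z 3) + M2)) Ovec := by
    fun_prop
  rw [hF2, lieBracket_add_right (ha.fun_smul h3) (h4.const_smul _), lieBracket_smul_right ha h3,
    lieBracket_const_smul_right h4, lieBracket_self]
  simp [X3_Ovec_apply_zero hdet, show Ovec 3 = 0 from rfl]

theorem contDiffAt_F2 {n : WithTop ℕ∞} {l1 l2 x1 x2 e1 e2 : ℝ}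
    (hdet : (Emat l1 l2 x1 x2 e1 e2 0).det ≠ 0) (M1 M2 : ℝ) :
    ContDiffAt ℝ n (F2 l1 l2 x1 x2 e1 e2 M1 M2) Ovec := by
  have ha : ContDiff ℝ n fun z : Fin 4 → ℝ => -(M1 * Real.cos (z 3) + M2) := by fun_prop
  exact (ha.contDiffAt.smul (contDiffAt_X3 hdet)).sub ((contDiffAt_X4 hdet).const_smul M2)

/-- Failure of Sussmann's condition when M1 + M2 ≠ 0. -/
theorem stmt_11 (l1 l2 x1 x2 e1 e2 k M1 M2 : ℝ)
    (hl1 : 0 < l1) (hl2 : 0 < l2) (hx1 : 0 < x1) (hx2 : 0 < x2)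
    (he1 : 0 < e1) (he2 : 0 < e2) (hk : 0 < k)
    (hA : AssumptionA l1 l2 x1 x2 e1 e2 M1 M2) :
    lieBr (F1 l1 l2 x1 x2 e1 e2 M1)
        (lieBr (F0 l1 l2 x1 x2 e1 e2 k) (F1 l1 l2 x1 x2 e1 e2 M1)) Ovec = 0 ∧
    (M1 + M2 ≠ 0 →
      lieBr (F2 l1 l2 x1 x2 e1 e2 M1 M2)
          (lieBr (F0 l1 l2 x1 x2 e1 e2 k) (F2 l1 l2 x1 x2 e1 e2 M1 M2)) Ovec ∉
        Submodule.span ℝ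
          ({X3 l1 l2 x1 x2 e1 e2 Ovec, X4 l1 l2 x1 x2 e1 e2 Ovec} :
            Set (Fin 4 → ℝ))) := by
  obtain ⟨hne, h1, h2, -, -, hM⟩ := hA
  have hdet := det_Emat_zero_ne_zero hl1 hl2 hx1 hx2 he1 he2
  have hF0 : F0 l1 l2 x1 x2 e1 e2 k Ovec = 0 := by simp [F0, Ovec]
  have hF1 : F1 l1 l2 x1 x2 e1 e2 M1 Ovec = 0 := by simp [F1, Ovec]
  refine ⟨lieBracket_eq_zero_of_eq_zero (𝕜 := ℝ) hF1
    (lieBracket_eq_zero_of_eq_zero (𝕜 := ℝ) hF0 hF1), fun hM12 hmem => ?_⟩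
  have hbad := lieBracket_lieBracket_smul_of_eq_zero (x := Ovec)
    (f := fun z : Fin 4 → ℝ => k * z 3) (by fun_prop) (contDiffAt_X4 hdet)
    (contDiffAt_F2 hdet M1 M2) (by simp [Ovec])
  have hbad0 := congrFun hbad 0
  have hkF2 : fderiv ℝ (fun z : Fin 4 → ℝ => k * z 3) Ovec (F2 l1 l2 x1 x2 e1 e2 M1 M2 Ovec) =
      k * F2 l1 l2 x1 x2 e1 e2 M1 M2 Ovec 3 := by
    have h : HasFDerivAt (fun z : Fin 4 → ℝ => k * z 3)
        (k • ContinuousLinearMap.proj (R := ℝ) (φ := fun _ : Fin 4 => ℝ) 3) Ovec :=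
      (hasFDerivAt_apply (3 : Fin 4) Ovec).const_mul k
    rw [h.fderiv]
    simp
  rw [Pi.sub_apply, Pi.smul_apply, Pi.smul_apply, X4_Ovec_apply_zero hdet, smul_zero, sub_zero,
    lieBracket_X4_F2_Ovec_apply_zero hdet, hkF2, smul_eq_mul] at hbad0
  obtain ⟨p, q, hpq⟩ := Submodule.mem_span_pair.1 hmem
  have hspan := congrFun hpq 0
  rw [Pi.add_apply, Pi.smul_apply, Pi.smul_apply, X3_Ovec_apply_zero hdet,
    X4_Ovec_apply_zero hdet, smul_zero, smul_zero, add_zero] at hspan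
  have hF23 := F2_Ovec_apply_three_ne_zero hl1 hl2 hx1 hx2 he1 he2 hM
  have hbr := lieBracket_X4_X3_Ovec_apply_zero_ne_zero hl1 hl2 hx1 hx2 he1 he2 h1 h2 hne
  exact mul_ne_zero (mul_ne_zero two_ne_zero (mul_ne_zero hk.ne' hF23))
    (mul_ne_zero (neg_ne_zero.2 hM12) hbr) (hbad0.symm.trans hspan.symm)
end

section
/- (Return trajectory.) Let Assumption A hold. Then there exist positive numbers k, T̄ and H̄ with the following property: for any T with 0 < T ≤ T̄ and any measurable control H = (H∥, H⊥) : [0, T/2] → ℝ² bounded by H̄, there exists a bounded measurable control H* = (H*∥, H*⊥) : [0, T] → ℝ² such that H*(t) = H(t) for 0 ≤ t ≤ T/2, ‖H*⊥‖∞ ≤ k‖H‖∞, ‖H*∥‖∞ ≤ 2κ|(M1+M2)/(M1·M2)| + k‖H‖∞, and the solution z* : [0,T] → ℝ⁴ of ż* = F0(z*) + H*∥(t) F1(z*) + H*⊥(t) F2(z*) with z*(0) = O = (0,0,0,0) satisfies z*(t) = z*(T − t) for all t ∈ [0, T] (in particular z*(T) = O) and its fourth component α*(t) remains in [−π/2,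 π/2] for all t ∈ [0,T]. -/
open Real Matrix Set

theorem ContDiffAt.matrix_det {V n : Type*} [NormedAddCommGroup V] [NormedSpace ℝ V]
    [Fintype n] [DecidableEq n] {A : V → Matrix n n ℝ} {v : V} {m : WithTop ℕ∞}
    (hA : ∀ i j, ContDiffAt ℝ m (fun x => A x i j) v) :
    ContDiffAt ℝ m (fun x => (A x).det) v := by
  simp only [Matrix.det_apply']
  exact ContDiffAt.sum fun σ _ => contDiffAt_const.mul (contDiffAt_prod fun i _ => hA _ _)

theorem ContDiffAt.matrix_inv {V n : Type*} [NormedAddCommGroup V] [NormedSpace ℝ V]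
    [Fintype n] [DecidableEq n] {A : V → Matrix n n ℝ} {v : V} {m : WithTop ℕ∞}
    (hA : ∀ i j, ContDiffAt ℝ m (fun x => A x i j) v) (hv : (A v).det ≠ 0) (i j : n) :
    ContDiffAt ℝ m (fun x => (A x)⁻¹ i j) v := by
  simp only [Matrix.inv_def, Ring.inverse_eq_inv', Matrix.smul_apply, smul_eq_mul,
    Matrix.adjugate_apply]
  refine ((ContDiffAt.matrix_det hA).inv hv).mul (ContDiffAt.matrix_det fun a b => ?_)
  by_cases h : a = j
  · subst h
    simpa using contDiffAt_const
  · simpa [Matrix.updateRow_ne h] using hA a b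

theorem Emat_zero_det_ne_zero {l1 l2 x1 x2 e1 e2 : ℝ} (hl1 : 0 < l1) (hl2 : 0 < l2)
    (hx1 : 0 < x1) (hx2 : 0 < x2) (he1 : 0 < e1) (he2 : 0 < e2) :
    (Emat l1 l2 x1 x2 e1 e2 0).det ≠ 0 := by
  have h : (Emat l1 l2 x1 x2 e1 e2 0).det =
      -((x1 * l1 + x2 * l2) *
        (l2 ^ 3 * l1 ^ 4 * e2 * e1 ^ 2 / 36 + l2 ^ 4 * l1 ^ 3 * e2 ^ 2 * e1 / 36)) := by
    simp [Emat, Matrix.det_succ_row_zero, Fin.sum_univ_succ, Fin.succAbove]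
    ring
  rw [h]
  exact (neg_neg_of_pos (by positivity)).ne

theorem contDiffAt_Emat_inv {l1 l2 x1 x2 e1 e2 : ℝ} (h : (Emat l1 l2 x1 x2 e1 e2 0).det ≠ 0)
    (i j : Fin 4) :
    ContDiffAt ℝ 1 (fun z : Fin 4 → ℝ => (Emat l1 l2 x1 x2 e1 e2 (z 3))⁻¹ i j) 0 := by
  refine ContDiffAt.matrix_inv (fun a b => ?_) (by simpa using h) i j
  fin_cases a <;> fin_cases b <;> simp [Emat] <;> fun_prop

theorem contDiffAt_Rtil_mulVec {g : (Fin 4 → ℝ) → Fin 4 → ℝ} {m : WithTop ℕ∞}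
    (hg : ∀ i, ContDiffAt ℝ m (fun z => g z i) 0) :
    ContDiffAt ℝ m (fun z : Fin 4 → ℝ => (Rtil (z 2)).mulVec (g z)) 0 := by
  refine contDiffAt_pi.2 fun i => ?_
  simp only [Matrix.mulVec, dotProduct]
  refine ContDiffAt.sum fun j _ => ContDiffAt.mul ?_ (hg j)
  fin_cases i <;> fin_cases j <;> simp [Rtil] <;> fun_prop

theorem contDiffAt_fields {l1 l2 x1 x2 e1 e2 : ℝ} (k M1 M2 : ℝ)
    (h : (Emat l1 l2 x1 x2 e1 e2 0).det ≠ 0) :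
    ContDiffAt ℝ 1 (F0 l1 l2 x1 x2 e1 e2 k) 0 ∧
      ContDiffAt ℝ 1 (F1 l1 l2 x1 x2 e1 e2 M1) 0 ∧
      ContDiffAt ℝ 1 (F2 l1 l2 x1 x2 e1 e2 M1 M2) 0 := by
  have h3 : ContDiffAt ℝ 1 (X3 l1 l2 x1 x2 e1 e2) 0 :=
    contDiffAt_Rtil_mulVec fun i => contDiffAt_Emat_inv h i 2
  have h4 : ContDiffAt ℝ 1 (X4 l1 l2 x1 x2 e1 e2) 0 :=
    contDiffAt_Rtil_mulVec fun i => contDiffAt_Emat_inv h i 3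
  have h1 : ContDiffAt ℝ 1 (fun z : Fin 4 → ℝ => k * z 3) 0 := by fun_prop
  have h2 : ContDiffAt ℝ 1 (fun z : Fin 4 → ℝ => M1 * Real.sin (z 3)) 0 := by fun_prop
  have h5 : ContDiffAt ℝ 1 (fun z : Fin 4 → ℝ => -(M1 * Real.cos (z 3) + M2)) 0 := by fun_prop
  exact ⟨h1.smul h4, h2.smul h3, (h5.smul h3).sub (contDiffAt_const (c := M2) |>.smul h4)⟩

/-- Global existence on a short interval for a bounded measurable right-hand side that is
Lipschitz in space. -/
theorem exists_forall_eq_add_integral {E : Type*} [NormedAddCommGroup E] [NormedSpace ℝ E]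
    [CompleteSpace E] [MeasurableSpace E] [BorelSpace E] [SecondCountableTopology E]
    {f : ℝ → E → E} (hf : Measurable (Function.uncurry f)) {K : NNReal}
    (hK : ∀ t, LipschitzWith K (f t)) {B : ℝ} (hB : ∀ t x, ‖f t x‖ ≤ B) {S : ℝ} (hS : 0 ≤ S)
    (hKS : K * S < 1) (x₀ : E) :
    ∃ z : ℝ → E, Continuous z ∧ (∀ a b, IntervalIntegrable (fun s => f s (z s)) MeasureTheory.volume a b) ∧
      ∀ t ∈ Icc 0 S, z t = x₀ + ∫ s in (0:ℝ)..t, f s (z s) := by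
  have hint : ∀ z : ℝ → E, Continuous z → ∀ a b,
      IntervalIntegrable (fun s => f s (z s)) MeasureTheory.volume a b := fun z hz a b =>
    (intervalIntegrable_const (c := B)).mono_fun'
      (hf.comp (measurable_id.prodMk hz.measurable)).aestronglyMeasurable
      (Filter.Eventually.of_forall fun t => hB t _)
  have hext : ∀ w : C(Icc (0:ℝ) S, E), Continuous (IccExtend hS w) := fun w =>
    w.continuous.Icc_extend'
  let Φ : C(Icc (0:ℝ) S, E) → C(Icc (0:ℝ) S, E) := fun w =>
    ⟨fun t => x₀ + ∫ s in (0:ℝ)..t, f s (IccExtend hS w s),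
      continuous_const.add ((intervalIntegral.continuous_primitive (hint _ (hext w)) 0).comp
        continuous_subtype_val)⟩
  have hΦ : ContractingWith (K * S.toNNReal) Φ := by
    refine ⟨?_, LipschitzWith.of_dist_le_mul fun w w' => ?_⟩
    · rw [← NNReal.coe_lt_coe]
      simpa [Real.coe_toNNReal S hS] using hKS
    refine (ContinuousMap.dist_le (by positivity)).2 fun t => ?_
    have hd : dist (Φ w t) (Φ w' t) = ‖∫ s in (0:ℝ)..t,
        (f s (IccExtend hS w s) - f s (IccExtend hS w' s))‖ := by
      rw [intervalIntegral.integral_sub (hint _ (hext w) _ _) (hint _ (hext w') _ _)]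
      simp [Φ, dist_eq_norm]
    rw [hd]
    refine (intervalIntegral.norm_integral_le_of_norm_le_const
      (C := K * dist w w') fun s _ => ?_).trans ?_
    · rw [← dist_eq_norm]
      refine ((hK s).dist_le_mul _ _).trans ?_
      gcongr
      exact ContinuousMap.dist_apply_le_dist _
    · have h1 := t.2.1
      have h2 := t.2.2
      rw [sub_zero, abs_of_nonneg h1]
      calc K * dist w w' * t ≤ K * dist w w' * S := by gcongr
        _ = _ := by rw [NNReal.coe_mul, Real.coe_toNNReal S hS]; ring
  obtain ⟨w, hw, -⟩ := hΦ.exists_fixedPoint 0 (edist_ne_top _ _)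
  refine ⟨IccExtend hS w, hext w, hint _ (hext w), fun t ht => ?_⟩
  rw [IccExtend_of_mem hS _ ht]
  exact (congrArg (fun u : C(Icc (0:ℝ) S, E) => u ⟨t, ht⟩) hw).symm

/-- Near the origin, a `C¹` function factors through the coordinatewise clamp as a globally
Lipschitz function. -/
theorem ContDiffAt.exists_lipschitzWith_clamp {n : ℕ} {F : (Fin n → ℝ) → Fin n → ℝ}
    (hF : ContDiffAt ℝ 1 F 0) :
    ∃ K : NNReal, ∃ ε > 0, ∀ r, 0 ≤ r → r ≤ ε →
      LipschitzWith K (fun z : Fin n → ℝ => F fun i => max (-r) (min r (z i))) := by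
  obtain ⟨K, t, ht, hK⟩ := hF.exists_lipschitzOnWith
  obtain ⟨ε, hε, hball⟩ := Metric.nhds_basis_closedBall.mem_iff.1 ht
  refine ⟨K, ε, hε, fun r hr hrε => ?_⟩
  have hp : LipschitzWith 1 (fun (z : Fin n → ℝ) i => max (-r) (min r (z i))) := by
    refine LipschitzWith.of_dist_le_mul fun z w => ?_
    rw [NNReal.coe_one, one_mul, dist_pi_le_iff dist_nonneg]
    intro i
    have := ((LipschitzWith.id.const_min r).const_max (-r)).dist_le_mul (z i) (w i)
    simp only [NNReal.coe_one, one_mul] at this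
    exact this.trans (dist_le_pi_dist z w i)
  have hmem : ∀ z : Fin n → ℝ, (fun i => max (-r) (min r (z i))) ∈ t := fun z => by
    refine hball ?_
    rw [mem_closedBall_zero_iff, pi_norm_le_iff_of_nonneg hε.le]
    intro i
    rw [Real.norm_eq_abs, abs_le]
    exact ⟨(neg_le_neg hrε).trans (le_max_left _ _),
      max_le (by linarith) ((min_le_left _ _).trans hrε)⟩
  refine LipschitzWith.of_dist_le_mul fun z w => ?_
  refine (hK.dist_le_mul _ (hmem z) _ (hmem w)).trans ?_
  gcongr
  simpa using hp.dist_le_mul z w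

/-- Short-time solvability of a control-affine system whose drift vanishes at the origin, with
trajectories controlled linearly by the size of the control. -/
theorem exists_controlAffine_trajectory {n : ℕ} {G0 G1 G2 : (Fin n → ℝ) → Fin n → ℝ}
    (h0 : ContDiffAt ℝ 1 G0 0) (h1 : ContDiffAt ℝ 1 G1 0) (h2 : ContDiffAt ℝ 1 G2 0)
    (hG0 : G0 0 = 0) :
    ∃ τ c : ℝ, 0 < τ ∧ 0 < c ∧ ∀ S, 0 ≤ S → S ≤ τ → ∀ u v : ℝ → ℝ, Measurable u →
      Measurable v → (∀ t ∈ Icc 0 S, |u t| ≤ 1 ∧ |v t| ≤ 1) →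
      ∃ z : ℝ → Fin n → ℝ, Continuous z ∧
        IntervalIntegrable (fun s => G0 (z s) + u s • G1 (z s) + v s • G2 (z s)) MeasureTheory.volume 0 S ∧
        (∀ t ∈ Icc 0 S, z t = ∫ s in (0:ℝ)..t, (G0 (z s) + u s • G1 (z s) + v s • G2 (z s))) ∧
        (∀ C, (∀ t ∈ Icc 0 S, |u t| ≤ C ∧ |v t| ≤ C) → ∀ t ∈ Icc 0 S, ‖z t‖ ≤ c * C) ∧
        ∀ t ∈ Icc 0 S, ‖z t‖ ≤ 1 := by
  obtain ⟨K0, ε0, hε0, hK0⟩ := h0.exists_lipschitzWith_clamp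
  obtain ⟨K1, ε1, hε1, hK1⟩ := h1.exists_lipschitzWith_clamp
  obtain ⟨K2, ε2, hε2, hK2⟩ := h2.exists_lipschitzWith_clamp
  obtain ⟨r, hr, hr1, hr0, hr1', hr2⟩ : ∃ r : ℝ, 0 < r ∧ r ≤ 1 ∧ r ≤ ε0 ∧ r ≤ ε1 ∧ r ≤ ε2 :=
    ⟨min (min 1 ε0) (min ε1 ε2), by positivity, by simp, by simp, by simp, by simp⟩
  replace hK0 := hK0 r hr.le hr0
  replace hK1 := hK1 r hr.le hr1'
  replace hK2 := hK2 r hr.le hr2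
  set p : (Fin n → ℝ) → Fin n → ℝ := fun z i => max (-r) (min r (z i)) with hp
  have hp_idem : ∀ z, p (p z) = p z := fun z => by
    funext i
    simp only [hp]
    have h : -r ≤ r := by linarith
    rw [min_eq_right (max_le h (min_le_left _ _)), max_eq_right (le_max_left _ _)]
  have hp_eq : ∀ z, ‖z‖ ≤ r → p z = z := fun z hz => by
    funext i
    have hi := abs_le.1 ((norm_le_pi_norm z i).trans hz)
    simp only [hp]
    rw [min_eq_right hi.2, max_eq_right hi.1]
  have hp_norm : ∀ z, ‖p z‖ ≤ 1 := fun z => by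
    rw [pi_norm_le_iff_of_nonneg zero_le_one]
    intro i
    rw [Real.norm_eq_abs, abs_le]
    exact ⟨(neg_le_neg hr1).trans (le_max_left _ _),
      max_le (by linarith) ((min_le_left _ _).trans hr1)⟩
  have hp0 : p 0 = 0 := hp_eq 0 (by simpa using hr.le)
  have hbd : ∀ (G : (Fin n → ℝ) → Fin n → ℝ) (K : NNReal),
      LipschitzWith K (fun z => G (p z)) → ∀ z, ‖G (p z)‖ ≤ ‖G 0‖ + K := fun G K hG z => by
    have := hG.dist_le_mul (p z) 0
    simp only [hp_idem, hp0, dist_eq_norm, sub_zero] at this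
    have h3 := norm_le_norm_add_norm_sub' (G (p z)) (G 0)
    have h4 : (K:ℝ) * ‖p z‖ ≤ K * 1 := by gcongr; exact hp_norm z
    linarith
  have hB0 := hbd G0 K0 hK0
  have hB1 := hbd G1 K1 hK1
  have hB2 := hbd G2 K2 hK2
  simp only [hG0, norm_zero, zero_add] at hB0
  set B : ℝ := K0 + (‖G1 0‖ + K1) + (‖G2 0‖ + K2) with hB
  set K : NNReal := K0 + K1 + K2 with hKdef
  have hBnn : 0 ≤ B := by positivity
  refine ⟨min (r / (B + 1)) (1 / (2 * (K + 1))), 2 * (r / (B + 1)) * (B + 1), by positivity,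
    by positivity, fun S hS hSτ u v hu hv huv => ?_⟩
  have hSB : S * (B + 1) ≤ r := by
    rw [← le_div_iff₀ (by positivity)]; exact hSτ.trans (min_le_left _ _)
  have hSK : S * (2 * (K + 1)) ≤ 1 := by
    rw [← le_div_iff₀ (by positivity)]; exact hSτ.trans (min_le_right _ _)
  set u' := (Icc (0:ℝ) S).indicator u with hu'
  set v' := (Icc (0:ℝ) S).indicator v with hv'
  have hbu : ∀ t, |u' t| ≤ 1 ∧ |v' t| ≤ 1 := fun t => by
    by_cases ht : t ∈ Icc (0:ℝ) S
    · simpa [hu', hv', ht] using huv t ht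
    · simp [hu', hv', ht]
  have hu'm : Measurable u' := hu.indicator measurableSet_Icc
  have hv'm : Measurable v' := hv.indicator measurableSet_Icc
  set f : ℝ → (Fin n → ℝ) → Fin n → ℝ :=
    fun t z => G0 (p z) + u' t • G1 (p z) + v' t • G2 (p z) with hf
  have hfm : Measurable (Function.uncurry f) := by
    refine ((hK0.continuous.measurable.comp measurable_snd).add
      ((hu'm.comp measurable_fst).smul (hK1.continuous.measurable.comp measurable_snd))).add
      ((hv'm.comp measurable_fst).smul (hK2.continuous.measurable.comp measurable_snd))
  have hsm : ∀ {a b : ℝ} {x : Fin n → ℝ}, |a| ≤ 1 → ‖x‖ ≤ b → ‖a • x‖ ≤ b :=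
    fun {a b x} ha hx => by
      rw [norm_smul, Real.norm_eq_abs]
      nlinarith [norm_nonneg x, abs_nonneg a]
  have hfK : ∀ t, LipschitzWith K (f t) := fun t => by
    refine LipschitzWith.of_dist_le_mul fun z w => ?_
    have e : f t z - f t w = (G0 (p z) - G0 (p w)) + u' t • (G1 (p z) - G1 (p w))
        + v' t • (G2 (p z) - G2 (p w)) := by
      simp only [hf, smul_sub]; abel
    have a0 := hK0.dist_le_mul z w
    have a1 := hK1.dist_le_mul z w
    have a2 := hK2.dist_le_mul z w
    rw [dist_eq_norm] at a0 a1 a2 ⊢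
    rw [e, hKdef]
    refine (norm_add₃_le).trans ?_
    have b1 := hsm (hbu t).1 a1
    have b2 := hsm (hbu t).2 a2
    push_cast
    linarith
  have hfB : ∀ t z, ‖f t z‖ ≤ B := fun t z =>
    (norm_add₃_le).trans (add_le_add (add_le_add (hB0 z) (hsm (hbu t).1 (hB1 z)))
      (hsm (hbu t).2 (hB2 z)))
  obtain ⟨z, hzc, hzi, hz⟩ := exists_forall_eq_add_integral hfm hfK hfB hS
    (by nlinarith [K.2]) 0
  simp only [zero_add] at hz
  have hzr : ∀ t ∈ Icc (0:ℝ) S, ‖z t‖ ≤ r := fun t ht => by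
    rw [hz t ht]
    refine (intervalIntegral.norm_integral_le_of_norm_le_const fun s _ => hfB s _).trans ?_
    rw [sub_zero, abs_of_nonneg ht.1]
    nlinarith [ht.1, ht.2]
  have hfz : ∀ t ∈ Icc (0:ℝ) S,
      f t (z t) = G0 (z t) + u t • G1 (z t) + v t • G2 (z t) := fun t ht => by
    simp [hf, hu', hv', ht, hp_eq _ (hzr t ht)]
  refine ⟨z, hzc, (hzi 0 S).congr fun s hs => ?_, fun t ht => ?_, fun C hC => ?_,
    fun t ht => (hzr t ht).trans hr1⟩
  · rw [uIoc_of_le hS] at hs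
    exact hfz s (Ioc_subset_Icc_self hs)
  · rw [hz t ht]
    refine intervalIntegral.integral_congr fun s hs => ?_
    rw [uIcc_of_le ht.1] at hs
    exact hfz s ⟨hs.1, hs.2.trans ht.2⟩
  · have hC0 : 0 ≤ C := (abs_nonneg _).trans (hC 0 ⟨le_rfl, hS⟩).1
    obtain ⟨t₀, ht₀, hmax⟩ := isCompact_Icc.exists_isMaxOn (nonempty_Icc.2 hS)
      hzc.norm.continuousOn
    have hmax' : ∀ t ∈ Icc (0:ℝ) S, ‖z t‖ ≤ ‖z t₀‖ := fun t ht => hmax ht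
    have hle : ∀ s ∈ Icc (0:ℝ) S, ‖f s (z s)‖ ≤ K * ‖z t₀‖ + B * C := fun s hs => by
      have a0 : dist (G0 (p (z s))) (G0 (p 0)) ≤ K0 * dist (z s) 0 := hK0.dist_le_mul (z s) 0
      rw [hp0, hG0, dist_zero_right, dist_zero_right] at a0
      have a1 : ‖u' s • G1 (p (z s))‖ ≤ C * (‖G1 0‖ + K1) := by
        rw [norm_smul, Real.norm_eq_abs]
        have := (hC s hs).1
        simp only [hu', indicator_of_mem hs]
        gcongr
        exact hB1 _
      have a2 : ‖v' s • G2 (p (z s))‖ ≤ C * (‖G2 0‖ + K2) := by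
        rw [norm_smul, Real.norm_eq_abs]
        have := (hC s hs).2
        simp only [hv', indicator_of_mem hs]
        gcongr
        exact hB2 _
      have a3 : (K0:ℝ) * ‖z s‖ ≤ K * ‖z t₀‖ := by
        gcongr
        · rw [hKdef, add_assoc]; exact_mod_cast le_self_add
        · exact hmax' s hs
      refine (norm_add₃_le).trans ?_
      have : 0 ≤ (K0:ℝ) * C := by positivity
      rw [hB]
      linarith
    have hm : ‖z t₀‖ ≤ (K * ‖z t₀‖ + B * C) * S := by
      conv_lhs => rw [hz t₀ ht₀]
      refine (intervalIntegral.norm_integral_le_of_norm_le_const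
        (C := K * ‖z t₀‖ + B * C) fun s hs => ?_).trans ?_
      · rw [uIoc_of_le ht₀.1] at hs
        exact hle s ⟨hs.1.le, hs.2.trans ht₀.2⟩
      · rw [sub_zero, abs_of_nonneg ht₀.1]
        gcongr
        exact ht₀.2
    intro t ht
    refine (hmax' t ht).trans ?_
    have e : 2 * (r / (B + 1)) * (B + 1) = 2 * r := by field_simp
    rw [e]
    have hSK' : S * K ≤ 1 / 2 := by nlinarith
    have hSB' : S * B ≤ r := by nlinarith
    nlinarith [mul_le_mul_of_nonneg_right hSK' (norm_nonneg (z t₀)),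
      mul_le_mul_of_nonneg_right hSB' hC0]

/-- Integrating a function that continues `g` antisymmetrically past the midpoint `T / 2`. -/
theorem integral_eq_of_antisymm_midpoint {E : Type*} [NormedAddCommGroup E] [NormedSpace ℝ E]
    {g h : ℝ → E} {T : ℝ} (hT : 0 ≤ T) (hg : IntervalIntegrable g MeasureTheory.volume 0 (T / 2))
    (hleft : ∀ s ∈ Icc 0 (T / 2), h s = g s) (hright : ∀ s ∈ Ioc (T / 2) T, h s = -g (T - s))
    {t : ℝ} (ht : t ∈ Icc 0 T) :
    ∫ s in (0:ℝ)..t, h s = ∫ s in (0:ℝ)..(min t (T - t)), g s := by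
  rcases le_total t (T / 2) with htT | htT
  · rw [min_eq_left (by linarith)]
    refine intervalIntegral.integral_congr fun s hs => ?_
    rw [uIcc_of_le ht.1] at hs
    exact hleft s ⟨hs.1, hs.2.trans htT⟩
  · rw [min_eq_right (by linarith)]
    have hsub : IntervalIntegrable g MeasureTheory.volume (T - t) (T / 2) :=
      hg.mono_set (by
        rw [uIcc_of_le (by linarith), uIcc_of_le (by linarith)]
        exact Icc_subset_Icc_left (by linarith [ht.2]))
    have hsub' : IntervalIntegrable g MeasureTheory.volume 0 (T - t) :=
      hg.mono_set (by
        rw [uIcc_of_le (by linarith [ht.2]), uIcc_of_le (by linarith)]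
        exact Icc_subset_Icc_right (by linarith))
    have hrefl : IntervalIntegrable (fun s => -g (T - s)) MeasureTheory.volume (T / 2) t := by
      have := (hsub.comp_sub_left T).symm.neg
      rwa [sub_sub_cancel, sub_half] at this
    have e1 : IntervalIntegrable h MeasureTheory.volume 0 (T / 2) := hg.congr fun s hs => by
      rw [uIoc_of_le (by linarith)] at hs
      exact (hleft s (Ioc_subset_Icc_self hs)).symm
    have e2 : ∀ s ∈ Set.uIoc (T / 2) t, -g (T - s) = h s := fun s hs => by
      rw [uIoc_of_le htT] at hs
      exact (hright s ⟨hs.1, hs.2.trans ht.2⟩).symm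
    have i1 : ∫ s in (0:ℝ)..(T / 2), h s = ∫ s in (0:ℝ)..(T / 2), g s :=
      intervalIntegral.integral_congr fun s hs => by
        rw [uIcc_of_le (by linarith)] at hs
        exact hleft s hs
    have i2 : ∫ s in (T / 2)..t, h s = -∫ s in (T - t)..(T / 2), g s := by
      rw [← intervalIntegral.integral_congr_ae (Filter.Eventually.of_forall e2),
        intervalIntegral.integral_neg, intervalIntegral.integral_comp_sub_left, sub_half]
    rw [← intervalIntegral.integral_add_adjacent_intervals e1 (hrefl.congr e2), i1, i2,
      ← intervalIntegral.integral_add_adjacent_intervals hsub' hsub, add_neg_cancel_right]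

/-- The controls reversing the velocity of the swimmer at a given state. -/
theorem F0_add_reversed (l1 l2 x1 x2 e1 e2 k u v : ℝ) {M1 M2 : ℝ} (hM1 : M1 ≠ 0) (hM2 : M2 ≠ 0)
    {z : Fin 4 → ℝ} (hz : |z 3| ≤ 1) :
    F0 l1 l2 x1 x2 e1 e2 k z
        + (2 * k * ((M1 * Real.cos (z 3) + M2) * (z 3 / Real.sin (z 3)) / (M1 * M2)) - u) •
          F1 l1 l2 x1 x2 e1 e2 M1 z
        + (2 * k * (z 3 / M2) - v) • F2 l1 l2 x1 x2 e1 e2 M1 M2 z =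
      -(F0 l1 l2 x1 x2 e1 e2 k z + u • F1 l1 l2 x1 x2 e1 e2 M1 z
        + v • F2 l1 l2 x1 x2 e1 e2 M1 M2 z) := by
  have hq : z 3 / Real.sin (z 3) * Real.sin (z 3) = z 3 := by
    by_cases h : z 3 = 0
    · simp [h]
    · refine div_mul_cancel₀ _ fun hs => h ?_
      have h' := abs_le.1 hz
      have := Real.pi_gt_three
      exact (Real.sin_eq_zero_iff_of_lt_of_lt (by linarith) (by linarith)).1 hs
  generalize z 3 / Real.sin (z 3) = q at hq
  simp only [F0, F1, F2]
  funext i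
  simp only [Pi.add_apply, Pi.neg_apply, Pi.sub_apply, Pi.smul_apply, smul_eq_mul]
  generalize X3 l1 l2 x1 x2 e1 e2 z i = p
  generalize X4 l1 l2 x1 x2 e1 e2 z i = r
  generalize Real.sin (z 3) = sn at hq ⊢
  generalize Real.cos (z 3) = cs
  have e1 : 2 * k * ((M1 * cs + M2) * q / (M1 * M2)) *
      (M1 * sn * p) = 2 * k * ((M1 * cs + M2) / M2 * z 3) * p := by
    rw [← hq]
    field_simp
  have e2 : 2 * k * (z 3 / M2) * (-(M1 * cs + M2) * p - M2 * r) =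
      -(2 * k * ((M1 * cs + M2) / M2 * z 3) * p) - 2 * k * z 3 * r := by
    field_simp
  linear_combination e1 + e2

theorem abs_div_sin_sub_one_le {a : ℝ} (ha : a ≠ 0) (ha1 : |a| ≤ 1) :
    |a / Real.sin a - 1| ≤ |a| := by
  have key : ∀ b : ℝ, 0 < b → b ≤ 1 → |b / Real.sin b - 1| ≤ b := fun b hb hb1 => by
    have h1 := Real.sin_gt_sub_cube hb
    have h2 := Real.sin_lt hb
    have h3 : 0 < Real.sin b := by nlinarith [pow_pos hb 3, mul_nonneg hb.le (sub_nonneg.2 hb1)]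
    rw [abs_of_nonneg (sub_nonneg.2 ((one_le_div h3).2 h2.le)), sub_le_iff_le_add,
      div_le_iff₀ h3]
    have h4 : (b + 1) * (b - b ^ 3 / 6) ≤ (b + 1) * Real.sin b := by gcongr
    nlinarith [pow_le_pow_of_le_one hb.le hb1 (show 2 ≤ 3 by simp),
      pow_le_pow_of_le_one hb.le hb1 (show 2 ≤ 4 by simp)]
  rcases lt_or_gt_of_ne ha with h | h
  · rw [abs_of_neg h] at ha1 ⊢
    simpa [Real.sin_neg, neg_div_neg_eq] using key (-a) (by linarith) ha1
  · rw [abs_of_pos h] at ha1 ⊢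
    exact key a h ha1

theorem abs_mul_div_sin_le (M1 M2 : ℝ) {a : ℝ} (ha : |a| ≤ 1) :
    |(M1 * Real.cos a + M2) * (a / Real.sin a)| ≤
      |M1 + M2| + (2 * |M1| + |M2|) * |a| := by
  by_cases h : a = 0
  · simp [h]
  have h1 := abs_div_sin_sub_one_le h ha
  have h2 : |Real.cos a - 1| ≤ |a| := by
    rw [abs_of_nonpos (by linarith [Real.cos_le_one a])]
    have := Real.one_sub_sq_div_two_le_cos (x := a)
    nlinarith [abs_nonneg a, sq_abs a]
  have h3 : |M1 * Real.cos a + M2| ≤ |M1| + |M2| := by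
    refine (abs_add_le _ _).trans (add_le_add_left ?_ _)
    rw [abs_mul]
    exact mul_le_of_le_one_right (abs_nonneg _) (Real.abs_cos_le_one a)
  have e : (M1 * Real.cos a + M2) * (a / Real.sin a) = (M1 + M2)
      + (M1 * Real.cos a + M2) * (a / Real.sin a - 1) + M1 * (Real.cos a - 1) := by ring
  have h4 : |(M1 * Real.cos a + M2) * (a / Real.sin a - 1)| ≤ (|M1| + |M2|) * |a| := by
    rw [abs_mul]; gcongr
  have h5 : |M1 * (Real.cos a - 1)| ≤ |M1| * |a| := by
    rw [abs_mul]; gcongr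
  rw [e]
  refine (abs_add_three _ _ _).trans ?_
  linarith

/-- Return trajectory, Lemma 1 of the paper. -/
theorem stmt_13 (l1 l2 x1 x2 e1 e2 k M1 M2 : ℝ)
    (hl1 : 0 < l1) (hl2 : 0 < l2) (hx1 : 0 < x1) (hx2 : 0 < x2)
    (he1 : 0 < e1) (he2 : 0 < e2) (hk : 0 < k)
    (hA : AssumptionA l1 l2 x1 x2 e1 e2 M1 M2) :
    ∃ kk Tb Hb : ℝ, 0 < kk ∧ 0 < Tb ∧ 0 < Hb ∧
      ∀ T : ℝ, 0 < T → T ≤ Tb →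
      ∀ Hpar Hperp : ℝ → ℝ, Measurable Hpar → Measurable Hperp →
        (∀ t ∈ Icc (0:ℝ) (T/2), |Hpar t| ≤ Hb ∧ |Hperp t| ≤ Hb) →
        ∃ Hspar Hsperp : ℝ → ℝ, Measurable Hspar ∧ Measurable Hsperp ∧
          (∀ t ∈ Icc (0:ℝ) (T/2), Hspar t = Hpar t ∧ Hsperp t = Hperp t) ∧
          (∀ C : ℝ, (∀ t ∈ Icc (0:ℝ) (T/2), |Hpar t| ≤ C ∧ |Hperp t| ≤ C) →
            (∀ t ∈ Icc (0:ℝ) T, |Hsperp t| ≤ kk * C) ∧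
            (∀ t ∈ Icc (0:ℝ) T, |Hspar t| ≤ 2*k*|(M1 + M2)/(M1*M2)| + kk * C)) ∧
          ∃ zs : ℝ → Fin 4 → ℝ,
            ContinuousOn zs (Icc 0 T) ∧ zs 0 = Ovec ∧
            (∀ t ∈ Icc (0:ℝ) T,
              zs t = Ovec + ∫ s in (0:ℝ)..t,
                (F0 l1 l2 x1 x2 e1 e2 k (zs s)
                  + Hspar s • F1 l1 l2 x1 x2 e1 e2 M1 (zs s)
                  + Hsperp s • F2 l1 l2 x1 x2 e1 e2 M1 M2 (zs s))) ∧
            (∀ t ∈ Icc (0:ℝ) T, zs t = zs (T - t)) ∧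
            (∀ t ∈ Icc (0:ℝ) T, zs t 3 ∈ Icc (-(Real.pi/2)) (Real.pi/2)) := by
  obtain ⟨-, -, -, hM1, hM2, -⟩ := hA
  obtain ⟨h0, h1, h2⟩ := contDiffAt_fields k M1 M2
    (Emat_zero_det_ne_zero hl1 hl2 hx1 hx2 he1 he2)
  obtain ⟨τ, c, hτ, hc, hex⟩ := exists_controlAffine_trajectory h0 h1 h2 (by simp [F0])
  have hOvec : Ovec = 0 := by
    funext i; fin_cases i <;> rfl
  set k1 : ℝ := 2 * k * (c / |M2|) with hk1
  set k2 : ℝ := 2 * k * ((2 * |M1| + |M2|) * c / |M1 * M2|) with hk2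
  have hk1' : 0 ≤ k1 := by positivity
  have hk2' : 0 ≤ k2 := by positivity
  refine ⟨k1 + k2 + 1, 2 * τ, 1, by positivity, by positivity, one_pos,
    fun T hT hTτ u v hu hv huv => ?_⟩
  obtain ⟨z, hzc, hzi, hz, hzC, hz1⟩ := hex (T / 2) (by linarith) (by linarith) u v hu hv huv
  have hz3 : ∀ t ∈ Icc (0:ℝ) (T / 2), |z t 3| ≤ 1 := fun t ht =>
    (norm_le_pi_norm (z t) 3).trans (hz1 t ht)
  have hz3C : ∀ C, (∀ t ∈ Icc (0:ℝ) (T / 2), |u t| ≤ C ∧ |v t| ≤ C) →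
      ∀ t ∈ Icc (0:ℝ) (T / 2), |z t 3| ≤ c * C := fun C hC t ht =>
    (norm_le_pi_norm (z t) 3).trans (hzC C hC t ht)
  have hmin : ∀ t ∈ Icc (0:ℝ) T, min t (T - t) ∈ Icc (0:ℝ) (T / 2) := fun t ht =>
    ⟨le_min ht.1 (by linarith [ht.2]), by
      rcases le_total t (T / 2) with h | h
      · exact (min_le_left _ _).trans h
      · exact (min_le_right _ _).trans (by linarith)⟩
  have hrefl : ∀ t ∈ Icc (0:ℝ) T, ¬t ≤ T / 2 → T - t ∈ Icc (0:ℝ) (T / 2) := fun t ht h =>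
    ⟨by linarith [ht.2], by linarith⟩
  have hα : Measurable fun t => z (T - t) 3 :=
    ((continuous_apply 3).comp (hzc.comp (continuous_const.sub continuous_id))).measurable
  refine ⟨fun t => if t ≤ T / 2 then u t else
      2 * k * ((M1 * Real.cos (z (T - t) 3) + M2) *
        (z (T - t) 3 / Real.sin (z (T - t) 3)) / (M1 * M2)) - u (T - t),
    fun t => if t ≤ T / 2 then v t else 2 * k * (z (T - t) 3 / M2) - v (T - t),
    Measurable.ite measurableSet_Iic hu (by fun_prop),
    Measurable.ite measurableSet_Iic hv (by fun_prop),
    fun t ht => ⟨if_pos ht.2, if_pos ht.2⟩, fun C hC => ?_, ?_⟩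
  · have hC0 : 0 ≤ C := (abs_nonneg _).trans (hC 0 ⟨le_rfl, by linarith⟩).1
    have hk1C : 0 ≤ k1 * C := by positivity
    have hk2C : 0 ≤ k2 * C := by positivity
    refine ⟨fun t ht => ?_, fun t ht => ?_⟩
    · by_cases h : t ≤ T / 2
      · simp only [if_pos h]
        linarith [(hC t ⟨ht.1, h⟩).2]
      · have hs := hrefl t ht h
        simp only [if_neg h]
        refine (abs_sub _ _).trans ?_
        have e : |2 * k * (z (T - t) 3 / M2)| ≤ k1 * C := by
          rw [abs_mul, abs_div, abs_of_pos (by positivity : 0 < 2 * k), hk1]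
          calc 2 * k * (|z (T - t) 3| / |M2|) ≤ 2 * k * (c * C / |M2|) := by
                gcongr; exact hz3C C hC _ hs
            _ = _ := by ring
        linarith [(hC _ hs).2]
    · have hnn : 0 ≤ 2 * k * |(M1 + M2) / (M1 * M2)| := by positivity
      by_cases h : t ≤ T / 2
      · simp only [if_pos h]
        linarith [(hC t ⟨ht.1, h⟩).1]
      · have hs := hrefl t ht h
        simp only [if_neg h]
        refine (abs_sub _ _).trans ?_
        have e : |2 * k * ((M1 * Real.cos (z (T - t) 3) + M2) *
            (z (T - t) 3 / Real.sin (z (T - t) 3)) / (M1 * M2))| ≤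
            2 * k * |(M1 + M2) / (M1 * M2)| + k2 * C := by
          rw [abs_mul, abs_div _ (M1 * M2), abs_of_pos (by positivity : 0 < 2 * k), hk2,
            abs_div (M1 + M2)]
          calc _ ≤ 2 * k * ((|M1 + M2| + (2 * |M1| + |M2|) * (c * C)) / |M1 * M2|) := by
                gcongr
                refine (abs_mul_div_sin_le M1 M2 (hz3 _ hs)).trans ?_
                gcongr
                exact hz3C C hC _ hs
            _ = _ := by ring
        linarith [(hC _ hs).1]
  · refine ⟨fun t => z (min t (T - t)), ?_, ?_, fun t ht => ?_, fun t _ => ?_, fun t ht => ?_⟩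
    · exact (hzc.comp (continuous_id.min (continuous_const.sub continuous_id))).continuousOn
    · have := hz 0 ⟨le_rfl, by linarith⟩
      simpa [min_eq_left hT.le, hOvec] using this
    · beta_reduce
      rw [hOvec, zero_add, hz _ (hmin t ht)]
      refine (integral_eq_of_antisymm_midpoint hT.le hzi (fun s hs => ?_) (fun s hs => ?_)
        ht).symm
      · simp only [if_pos hs.2, min_eq_left (show s ≤ T - s by linarith [hs.2])]
      · simp only [if_neg (not_le.2 hs.1), min_eq_right (show T - s ≤ s by linarith [hs.1])]
        exact F0_add_reversed _ _ _ _ _ _ _ _ _ hM1 hM2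
          (hz3 _ ⟨by linarith [hs.2], by linarith [hs.1]⟩)
    · simp only [sub_sub_cancel, min_comm]
    · have := abs_le.1 (hz3 _ (hmin t ht))
      have hpi := Real.pi_gt_three
      exact ⟨by linarith, by linarith⟩
end

section
/- (Linear controllability along trajectories.) Let Assumption A hold. For any ε > 0 there exists β with 0 < β < ε such that the following holds. Let t ↦ z^β(t) be the solution on [0, ∞) of ż = F0(z) + β F2(z) with z^β(0) = O = (0,0,0,0). Set A(t) = the Jacobian of the map z ↦ F0(z) + β F2(z) at z^β(t), and B(t) = the 4×2 matrix with columns F1(z^β(t)) and F2(z^β(t)). Then for every τ > 0 the time-varying linear control system ẏ(t) = A(t) y(t) + B(t) v(t) is controllable on [0, τ]: for all y0, y1 ∈ ℝ⁴ there exists a bounded measurable control v : [0,τ] → ℝ² whose corresponding solution satisfies y(0) = y0 and y(τ) = y1. -/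
open Real Matrix Set

/-- A `C¹` vector field of at most linear growth on a finite-dimensional space has global
integral curves. -/
lemma exists_global_integralCurve {E : Type*} [NormedAddCommGroup E] [NormedSpace ℝ E]
    [FiniteDimensional ℝ E] {f : E → E} (hf : ContDiff ℝ 1 f) {C : ℝ}
    (hC : ∀ x, ‖f x‖ ≤ C * (1 + ‖x‖)) (x₀ : E) :
    ∃ γ : ℝ → E, γ 0 = x₀ ∧ ∀ t, HasDerivAt γ (f (γ t)) t := by
  have hC0 : 0 ≤ C := by
    have := (norm_nonneg _).trans (hC 0)
    simpa using this
  have : CompleteSpace E := FiniteDimensional.complete ℝ E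
  have key : ∃ γ : ℝ → E, γ 0 = x₀ ∧ IsMIntegralCurve (I := modelWithCornersSelf ℝ E) γ f := by
    have hε : (0 : ℝ) < 1 / (2 * C + 1) := by positivity
    refine exists_isMIntegralCurve_of_isMIntegralCurveOn (I := modelWithCornersSelf ℝ E)
      (contMDiff_vectorSpace_iff_contDiff.2 hf) hε (fun x => ?_) x₀
    set ε : ℝ := 1 / (2 * C + 1)
    have hεmul : 2 * C * ε ≤ 1 := by
      have : (2 * C + 1) * ε = 1 := mul_one_div_cancel (by positivity)
      linarith
    obtain ⟨K, hK⟩ := (hf.contDiffOn (s := Metric.closedBall x (1 + ‖x‖))).exists_lipschitzOnWith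
      one_ne_zero (convex_closedBall _ _) (isCompact_closedBall _ _)
    have h0 : (0 : ℝ) ∈ Icc (-ε) ε := ⟨by linarith, hε.le⟩
    obtain ⟨a, ha⟩ : ∃ a : NNReal, (a : ℝ) = 1 + ‖x‖ := ⟨⟨1 + ‖x‖, by positivity⟩, rfl⟩
    obtain ⟨N, hN⟩ : ∃ N : NNReal, (N : ℝ) = 2 * C * (1 + ‖x‖) := ⟨⟨_, by positivity⟩, rfl⟩
    rw [← ha] at hK
    have hPL : IsPicardLindelof (fun _ => f) (⟨0, h0⟩ : Icc (-ε) ε) x a 0 N K := by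
      refine IsPicardLindelof.of_time_independent (fun y hy => ?_) hK ?_
      · have hy' : ‖y - x‖ ≤ 1 + ‖x‖ := by simpa [dist_eq_norm, ha] using hy
        have h1 : ‖y‖ ≤ ‖y - x‖ + ‖x‖ := by simpa using norm_add_le (y - x) x
        calc ‖f y‖ ≤ C * (1 + ‖y‖) := hC y
          _ ≤ C * (2 * (1 + ‖x‖)) := by gcongr; linarith
          _ = N := by rw [hN]; ring
      · have : 2 * C * ε * (1 + ‖x‖) ≤ 1 * (1 + ‖x‖) := by gcongr
        simp only [sub_zero, zero_sub, neg_neg, max_self, NNReal.coe_zero, ha, hN]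
        linarith
    obtain ⟨γ, h1, h2⟩ := hPL.exists_eq_forall_mem_Icc_hasDerivWithinAt₀
    refine ⟨γ, h1, fun t ht => ?_⟩
    exact hasMFDerivWithinAt_iff_hasFDerivWithinAt.2
      ((h2 t (Ioo_subset_Icc_self ht)).mono Ioo_subset_Icc_self).hasFDerivWithinAt
  obtain ⟨γ, h1, h2⟩ := key
  refine ⟨γ, h1, fun t => ?_⟩
  have : HasFDerivAt γ ((1 : ℝ →L[ℝ] ℝ).smulRight (f (γ t)) : ℝ →L[ℝ] E) t :=
    hasMFDerivAt_iff_hasFDerivAt.1 (h2 t)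
  exact this.hasDerivAt.congr_deriv (by simp)

/-- A linear ODE with `C¹` coefficients on a finite-dimensional space has solutions on `[0, T]`. -/
lemma exists_linear_solution {F : Type*} [NormedAddCommGroup F] [NormedSpace ℝ F]
    [FiniteDimensional ℝ F] {A : ℝ → F →L[ℝ] F} (hA : ContDiff ℝ 1 A) (T : ℝ) (x₀ : F) :
    ∃ y : ℝ → F, y 0 = x₀ ∧ ∀ t ∈ Icc 0 T, HasDerivAt y (A t (y t)) t := by
  obtain ⟨χ, hχc, hχs, -, hχ⟩ : ∃ χ : ℝ → ℝ, HasCompactSupport χ ∧ ContDiff ℝ 1 χ ∧ True ∧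
      ∀ t ∈ Icc 0 T, χ t = 1 := by
    let b : ContDiffBump (0 : ℝ) := ⟨|T| + 1, |T| + 2, by positivity, by linarith⟩
    refine ⟨b, b.hasCompactSupport, b.contDiff, trivial, fun t ht => b.one_of_mem_closedBall ?_⟩
    have := le_abs_self T
    simp only [b, mem_closedBall_zero_iff, Real.norm_eq_abs, abs_of_nonneg ht.1]
    linarith [ht.2]
  have hs : ContDiff ℝ 1 fun t => χ t • A t := hχs.smul hA
  obtain ⟨C, hC⟩ := (hχc.smul_right (f' := A)).exists_bound_of_continuous hs.continuous
  have hC0 : 0 ≤ C := (norm_nonneg _).trans (hC 0)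
  obtain ⟨γ, h0, hγ⟩ := exists_global_integralCurve
    (f := fun p : ℝ × F => ((1 : ℝ), (χ p.1 • A p.1) p.2)) (C := 1 + C)
    (contDiff_const.prodMk ((hs.comp contDiff_fst).clm_apply contDiff_snd))
    (fun p => by
      refine (norm_prod_le_iff.2 ⟨?_, ?_⟩)
      · have := norm_nonneg p
        simp only [norm_one]
        nlinarith
      · have h1 := (χ p.1 • A p.1).le_opNorm p.2
        have h2 : ‖p.2‖ ≤ ‖p‖ := norm_snd_le p
        calc _ ≤ _ := h1
          _ ≤ C * ‖p‖ := by gcongr; exact hC p.1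
          _ ≤ _ := by nlinarith [norm_nonneg p]) (0, x₀)
  have h1 : ∀ t, HasDerivAt (fun s => (γ s).1) 1 t := fun t =>
    (ContinuousLinearMap.fst ℝ ℝ F).hasFDerivAt.comp_hasDerivAt t (hγ t)
  have h2 : ∀ t, (γ t).1 = t := by
    have hd : ∀ t, HasDerivAt (fun s => (γ s).1 - s) 0 t := fun t =>
      ((h1 t).sub (hasDerivAt_id t)).congr_deriv (sub_self 1)
    intro t
    have := is_const_of_deriv_eq_zero (fun t => (hd t).differentiableAt)
      (fun t => (hd t).deriv) t 0
    simpa [h0, sub_eq_zero] using this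
  refine ⟨fun t => (γ t).2, by simp [h0], fun t ht => ?_⟩
  have : HasDerivAt (fun s => (γ s).2) ((χ (γ t).1 • A (γ t).1) (γ t).2) t :=
    (ContinuousLinearMap.snd ℝ ℝ F).hasFDerivAt.comp_hasDerivAt t (hγ t)
  rwa [h2, hχ t ht, one_smul] at this

/-- Duality for linear control systems: either every transfer is possible with a bounded
measurable control, or some nowhere vanishing solution of the adjoint equation annihilates the
control vector fields. -/
lemma controllable_or_exists_adjoint {E : Type*} [NormedAddCommGroup E] [NormedSpace ℝ E]
    [FiniteDimensional ℝ E] {A : ℝ → E →L[ℝ] E} (hA : ContDiff ℝ 1 A) {b₁ b₂ : ℝ → E}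
    (hb₁ : Continuous b₁) (hb₂ : Continuous b₂) {τ : ℝ} (hτ : 0 < τ) :
    (∀ y0 y1 : E, ∃ v : ℝ → Fin 2 → ℝ, Measurable v ∧ (∃ C : ℝ, ∀ t, ‖v t‖ ≤ C) ∧
      ∃ y : ℝ → E, y 0 = y0 ∧ y τ = y1 ∧ ∀ t ∈ Icc (0 : ℝ) τ,
        HasDerivWithinAt y (A t (y t) + v t 0 • b₁ t + v t 1 • b₂ t) (Icc 0 τ) t) ∨
    ∃ p : ℝ → E →L[ℝ] ℝ, ∀ t ∈ Icc (0 : ℝ) τ,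
      p t ≠ 0 ∧ HasDerivAt p (-(p t).comp (A t)) t ∧ p t (b₁ t) = 0 ∧ p t (b₂ t) = 0 := by
  have : CompleteSpace E := FiniteDimensional.complete ℝ E
  obtain ⟨Φ, hΦ0, hΦ⟩ := exists_linear_solution
    (A := fun t => ContinuousLinearMap.compL ℝ E E E (A t))
    ((ContinuousLinearMap.compL ℝ E E E).contDiff.comp hA) τ (ContinuousLinearMap.id ℝ E)
  obtain ⟨Ψ, hΨ0, hΨ⟩ := exists_linear_solution
    (A := fun t => -(ContinuousLinearMap.compL ℝ E E E).flip (A t))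
    (((ContinuousLinearMap.compL ℝ E E E).flip.contDiff.comp hA).neg) τ
    (ContinuousLinearMap.id ℝ E)
  replace hΦ : ∀ t ∈ Icc 0 τ, HasDerivAt Φ ((A t).comp (Φ t)) t := fun t ht => by
    simpa using hΦ t ht
  replace hΨ : ∀ t ∈ Icc 0 τ, HasDerivAt Ψ (-(Ψ t).comp (A t)) t := fun t ht => by
    simpa using hΨ t ht
  have hΨΦ : ∀ t ∈ Icc 0 τ, (Ψ t).comp (Φ t) = ContinuousLinearMap.id ℝ E := by
    have hd : ∀ t ∈ Icc 0 τ, HasDerivAt (fun s => (Ψ s).comp (Φ s)) 0 t := fun t ht => by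
      refine ((hΨ t ht).clm_comp (hΦ t ht)).congr_deriv ?_
      ext x
      simp
    intro t ht
    have := constant_of_has_deriv_right_zero (a := 0) (b := τ)
      (fun s hs => (hd s hs).continuousAt.continuousWithinAt)
      (fun s hs => (hd s (Ico_subset_Icc_self hs)).hasDerivWithinAt) t ht
    simpa [hΦ0, hΨ0] using this
  have hΦΨ : ∀ t ∈ Icc 0 τ, ∀ x, Φ t (Ψ t x) = x := by
    intro t ht x
    have h : (Ψ t : E →ₗ[ℝ] E) * (Φ t : E →ₗ[ℝ] E) = 1 := by
      ext x
      simpa using congrArg (fun L => L x) (hΨΦ t ht)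
    have h' := mul_eq_one_comm.1 h
    simpa using congrArg (fun L => L x) h'
  have hΨc : ContinuousOn Ψ (Icc 0 τ) := fun t ht => (hΨ t ht).continuousAt.continuousWithinAt
  have hc₁ : ContinuousOn (fun t => Ψ t (b₁ t)) (Icc 0 τ) := hΨc.clm_apply hb₁.continuousOn
  have hc₂ : ContinuousOn (fun t => Ψ t (b₂ t)) (Icc 0 τ) := hΨc.clm_apply hb₂.continuousOn
  let g : (ℝ → ℝ) × (ℝ → ℝ) → ℝ → E := fun v t => v.1 t • Ψ t (b₁ t) + v.2 t • Ψ t (b₂ t)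
  have hg : ∀ v : (ℝ → ℝ) × (ℝ → ℝ), ContinuousOn v.1 (Icc 0 τ) → ContinuousOn v.2 (Icc 0 τ) →
      ContinuousOn (g v) (Icc 0 τ) := fun v h1 h2 => (h1.smul hc₁).add (h2.smul hc₂)
  have hgi : ∀ v : (ℝ → ℝ) × (ℝ → ℝ), ContinuousOn v.1 (Icc 0 τ) → ContinuousOn v.2 (Icc 0 τ) →
      IntervalIntegrable (g v) MeasureTheory.volume 0 τ := fun v h1 h2 => by
    refine ContinuousOn.intervalIntegrable ?_
    rw [uIcc_of_le hτ.le]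
    exact hg v h1 h2
  let R : Submodule ℝ E :=
    { carrier := {x | ∃ v : (ℝ → ℝ) × (ℝ → ℝ), ContinuousOn v.1 (Icc 0 τ) ∧
        ContinuousOn v.2 (Icc 0 τ) ∧ ∫ t in (0 : ℝ)..τ, g v t = x}
      zero_mem' := ⟨0, continuousOn_const, continuousOn_const, by simp [g]⟩
      add_mem' := by
        rintro _ _ ⟨v, h1, h2, rfl⟩ ⟨w, h3, h4, rfl⟩
        refine ⟨v + w, h1.add h3, h2.add h4, ?_⟩
        rw [← intervalIntegral.integral_add (hgi v h1 h2) (hgi w h3 h4)]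
        congr 1
        ext t
        simp only [g, Prod.fst_add, Prod.snd_add, Pi.add_apply, add_smul]
        abel
      smul_mem' := by
        rintro c _ ⟨v, h1, h2, rfl⟩
        refine ⟨c • v, h1.const_smul c, h2.const_smul c, ?_⟩
        rw [← intervalIntegral.integral_smul]
        congr 1
        ext t
        simp [g, smul_smul] }
  by_cases hR : R = ⊤
  · left
    intro y0 y1
    have hmem : Ψ τ y1 - y0 ∈ R := hR ▸ Submodule.mem_top
    obtain ⟨v, h1, h2, hv⟩ := hmem
    let w : ℝ → Fin 2 → ℝ := fun t => (Icc 0 τ).indicator (fun t => ![v.1 t, v.2 t]) t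
    have hvc : ContinuousOn (fun t => ![v.1 t, v.2 t]) (Icc 0 τ) := by
      refine continuousOn_pi.2 fun i => ?_
      fin_cases i
      · exact h1
      · exact h2
    refine ⟨w, ?_, ?_, ?_⟩
    · classical
      have hw : w = (Icc 0 τ).piecewise (fun t => ![v.1 t, v.2 t]) 0 := by
        rw [piecewise_eq_indicator]
      rw [hw]
      exact hvc.measurable_piecewise continuousOn_const measurableSet_Icc
    · obtain ⟨C, hC⟩ := isCompact_Icc.exists_bound_of_continuousOn hvc
      refine ⟨max C 0, fun t => ?_⟩
      by_cases ht : t ∈ Icc 0 τ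
      · simp only [w, indicator_of_mem ht]
        exact (hC t ht).trans (le_max_left _ _)
      · simp [w, indicator_of_notMem ht]
    · refine ⟨fun t => Φ t (y0 + ∫ s in (0 : ℝ)..t, g v s), by simp [hΦ0], ?_, fun t ht => ?_⟩
      · simp only [hv]
        simpa using hΦΨ τ ⟨hτ.le, le_rfl⟩ y1
      · have hI : HasDerivWithinAt (fun u => ∫ s in (0 : ℝ)..u, g v s) (g v t) (Icc 0 τ) t := by
          have : Fact (t ∈ Icc 0 τ) := ⟨ht⟩
          refine intervalIntegral.integral_hasDerivWithinAt_right ?_ ?_ (hg v h1 h2 t ht)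
          · exact (hgi v h1 h2).mono_set (by
              rw [uIcc_of_le ht.1, uIcc_of_le hτ.le]
              exact Icc_subset_Icc_right ht.2)
          · exact (hg v h1 h2).stronglyMeasurableAtFilter_nhdsWithin measurableSet_Icc t
        have := ((hΦ t ht).hasDerivWithinAt (s := Icc 0 τ)).clm_apply (hI.const_add y0)
        refine this.congr_deriv ?_
        simp only [w, indicator_of_mem ht, g, map_add, map_smul, hΦΨ t ht]
        simp [add_assoc]
  · right
    obtain ⟨f, hf0, hf⟩ := R.exists_le_ker_of_lt_top (lt_top_iff_ne_top.2 hR)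
    let q : E →L[ℝ] ℝ := LinearMap.toContinuousLinearMap f
    have hq : ∀ x, q x = f x := fun x => rfl
    have hq1 : ContinuousOn (fun t => q (Ψ t (b₁ t))) (Icc 0 τ) := q.continuous.comp_continuousOn hc₁
    have hq2 : ContinuousOn (fun t => q (Ψ t (b₂ t))) (Icc 0 τ) := q.continuous.comp_continuousOn hc₂
    have hint : ∫ t in (0 : ℝ)..τ, ((q (Ψ t (b₁ t))) ^ 2 + (q (Ψ t (b₂ t))) ^ 2) = 0 := by
      have hx : (∫ t in (0 : ℝ)..τ, g (fun t => q (Ψ t (b₁ t)), fun t => q (Ψ t (b₂ t))) t) ∈ R :=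
        ⟨_, hq1, hq2, rfl⟩
      have h0 : q (∫ t in (0 : ℝ)..τ, g (fun t => q (Ψ t (b₁ t)), fun t => q (Ψ t (b₂ t))) t) = 0 :=
        hf hx
      rw [← ContinuousLinearMap.intervalIntegral_comp_comm _ (hgi _ hq1 hq2)] at h0
      rw [← h0]
      congr 1
      ext t
      simp [g, sq]
    have hzero : ∀ t ∈ Icc 0 τ, (q (Ψ t (b₁ t))) ^ 2 + (q (Ψ t (b₂ t))) ^ 2 = 0 := by
      by_contra! hne
      obtain ⟨t, ht, hne⟩ := hne
      have hpos := intervalIntegral.integral_pos hτ ((hq1.pow 2).add (hq2.pow 2))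
        (fun s _ => add_nonneg (sq_nonneg _) (sq_nonneg _))
        ⟨t, ht, lt_of_le_of_ne (add_nonneg (sq_nonneg _) (sq_nonneg _)) hne.symm⟩
      exact hpos.ne' hint
    refine ⟨fun t => q.comp (Ψ t), fun t ht => ⟨fun h => hf0 ?_, ?_, ?_, ?_⟩⟩
    · ext x
      have := congrArg (fun L => L (Φ t x)) h
      have h2 := congrArg (fun L => L x) (hΨΦ t ht)
      simp only [ContinuousLinearMap.comp_apply, ContinuousLinearMap.id_apply] at this h2
      rw [h2] at this
      exact this
    · refine ((hasDerivAt_const t q).clm_comp (hΨ t ht)).congr_deriv ?_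
      ext x
      simp
    · have := hzero t ht
      simp only [ContinuousLinearMap.comp_apply]
      nlinarith [sq_nonneg (q (Ψ t (b₁ t))), sq_nonneg (q (Ψ t (b₂ t)))]
    · have := hzero t ht
      simp only [ContinuousLinearMap.comp_apply]
      nlinarith [sq_nonneg (q (Ψ t (b₁ t))), sq_nonneg (q (Ψ t (b₂ t)))]

lemma contDiff_matrix_det {ι : Type*} [Fintype ι] [DecidableEq ι] {n : WithTop ℕ∞}
    {A : ℝ → Matrix ι ι ℝ} (hA : ∀ i j, ContDiff ℝ n fun a => A a i j) :
    ContDiff ℝ n fun a => (A a).det := by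
  simp only [Matrix.det_apply]
  exact ContDiff.sum fun σ _ => (contDiff_prod fun i _ => hA _ _).const_smul _

lemma contDiff_matrix_inv {ι : Type*} [Fintype ι] [DecidableEq ι] {n : WithTop ℕ∞}
    {A : ℝ → Matrix ι ι ℝ} (hA : ∀ i j, ContDiff ℝ n fun a => A a i j)
    (hdet : ∀ a, (A a).det ≠ 0) (i j : ι) : ContDiff ℝ n fun a => (A a)⁻¹ i j := by
  simp only [Matrix.inv_def, Ring.inverse_eq_inv', Matrix.smul_apply, smul_eq_mul,
    Matrix.adjugate_apply]
  refine ((contDiff_matrix_det hA).inv hdet).mul (contDiff_matrix_det fun i' j' => ?_)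
  simp only [Matrix.updateRow_apply]
  split_ifs
  · exact contDiff_const
  · exact hA _ _

lemma Emat_mulVec (l1 l2 x1 x2 e1 e2 a : ℝ) (v : Fin 4 → ℝ) :
    Emat l1 l2 x1 x2 e1 e2 a *ᵥ v =
      ![-(x1*l1 + x2*l2) * cos a * v 0 - (x1*l1 + e2*l2) * sin a * v 1
          + (1/2)*x1*l1*l2*sin a * v 2,
        (e1*l1 + x2*l2) * sin a * v 0 - (e1*l1 + e2*l2) * cos a * v 1
          + (1/2)*e1*l1*(l1 + l2*cos a) * v 2 + (1/2)*e1*l1^2 * v 3,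
        -((1/2)*e1*l1^2*sin a) * v 0 + (1/2)*(e1*l1^2*cos a - e2*l2^2) * v 1
          - (e1*l1^2*((1/4)*l2*cos a + (1/3)*l1) + e2*l2^2*((1/12)*l2)) * v 2
          - e1*l1^2*((1/3)*l1) * v 3,
        -((1/2)*e2*l2^2) * v 1 - e2*l2^2*((1/12)*l2) * v 2] := by
  ext i
  fin_cases i <;> simp [Emat, Matrix.mulVec, dotProduct, Fin.sum_univ_four] <;> ring

lemma Emat_det_ne_zero {l1 l2 x1 x2 e1 e2 : ℝ} (hl1 : 0 < l1) (hl2 : 0 < l2) (hx1 : 0 < x1)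
    (hx2 : 0 < x2) (he1 : 0 < e1) (he2 : 0 < e2) (a : ℝ) :
    (Emat l1 l2 x1 x2 e1 e2 a).det ≠ 0 := by
  intro hdet
  obtain ⟨v, hv, h⟩ := Matrix.exists_mulVec_eq_zero_iff.2 hdet
  rw [Emat_mulVec] at h
  have h0 := congrFun h 0
  have h1 := congrFun h 1
  have h2 := congrFun h 2
  have h3 := congrFun h 3
  simp only [Matrix.cons_val, Pi.zero_apply] at h0 h1 h2 h3
  have hcs := sin_sq_add_cos_sq a
  set c := cos a
  set s := sin a
  obtain ⟨V1, hV1⟩ : ∃ x, x = c * v 0 + s * v 1 - l2 / 2 * s * v 2 := ⟨_, rfl⟩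
  obtain ⟨V2, hV2⟩ : ∃ x, x = -s * v 0 + c * v 1 - l2 / 2 * c * v 2 - l1 / 2 * (v 2 + v 3) :=
    ⟨_, rfl⟩
  have power : x1 * l1 * V1 ^ 2 + e1 * l1 * V2 ^ 2 + e1 * l1 ^ 3 / 12 * (v 2 + v 3) ^ 2
      + x2 * l2 * v 0 ^ 2 + e2 * l2 * v 1 ^ 2 + e2 * l2 ^ 3 / 12 * v 2 ^ 2 = 0 := by
    rw [hV1, hV2]
    linear_combination (-(c * v 0 + s * v 1 - l2 / 2 * s * v 2)) * h0
      - (-s * v 0 + c * (v 1 - l2 / 2 * v 2)) * h1 - (v 2 + v 3) * h2 + v 3 * h3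
      - (x2 * l2 * v 0 ^ 2 + e2 * l2 * v 1 ^ 2 - e2 * l2 ^ 2 / 2 * v 1 * v 2) * hcs
  have p1 : 0 ≤ x1 * l1 * V1 ^ 2 := by positivity
  have p2 : 0 ≤ e1 * l1 * V2 ^ 2 := by positivity
  have p3 : 0 ≤ e1 * l1 ^ 3 / 12 * (v 2 + v 3) ^ 2 := by positivity
  have p4 : 0 ≤ x2 * l2 * v 0 ^ 2 := by positivity
  have p5 : 0 ≤ e2 * l2 * v 1 ^ 2 := by positivity
  have p6 : 0 ≤ e2 * l2 ^ 3 / 12 * v 2 ^ 2 := by positivity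
  have q3 : e1 * l1 ^ 3 / 12 * (v 2 + v 3) ^ 2 = 0 := by linarith
  have q4 : x2 * l2 * v 0 ^ 2 = 0 := by linarith
  have q5 : e2 * l2 * v 1 ^ 2 = 0 := by linarith
  have q6 : e2 * l2 ^ 3 / 12 * v 2 ^ 2 = 0 := by linarith
  have r3 : v 2 + v 3 = 0 := by simpa [he1.ne', hl1.ne'] using q3
  have r4 : v 0 = 0 := by simpa [hx2.ne', hl2.ne'] using q4
  have r5 : v 1 = 0 := by simpa [he2.ne', hl2.ne'] using q5
  have r6 : v 2 = 0 := by simpa [he2.ne', hl2.ne'] using q6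
  refine hv ?_
  ext i
  fin_cases i
  · exact r4
  · exact r5
  · exact r6
  · simpa [r6] using r3

lemma contDiff_Emat_apply (l1 l2 x1 x2 e1 e2 : ℝ) {n : WithTop ℕ∞} (i j : Fin 4) :
    ContDiff ℝ n fun a => Emat l1 l2 x1 x2 e1 e2 a i j := by
  fin_cases i <;> fin_cases j <;> simp [Emat] <;> fun_prop

lemma Rtil_mulVec (th : ℝ) (v : Fin 4 → ℝ) :
    Rtil th *ᵥ v = ![cos th * v 0 - sin th * v 1, sin th * v 0 + cos th * v 1, v 2, v 3] := by
  ext i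
  fin_cases i <;> simp [Rtil, Matrix.mulVec, dotProduct, Fin.sum_univ_four] <;> ring

/-- The moments exerted on the swimmer at relative angle `a`, for the constant control `β`. -/
noncomputable def loads (k M1 M2 β a : ℝ) : Fin 4 → ℝ :=
  ![0, 0, -(β * (M1 * cos a + M2)), k * a - β * M2]

/-- The controlled drift at relative angle `a`, expressed in the body frame. -/
noncomputable def bodyField (l1 l2 x1 x2 e1 e2 k M1 M2 β a : ℝ) : Fin 4 → ℝ :=
  (Emat l1 l2 x1 x2 e1 e2 a)⁻¹ *ᵥ loads k M1 M2 β a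

lemma bodyField_eq (l1 l2 x1 x2 e1 e2 k M1 M2 β a : ℝ) :
    bodyField l1 l2 x1 x2 e1 e2 k M1 M2 β a =
      (-(β * (M1 * cos a + M2))) • (fun i => (Emat l1 l2 x1 x2 e1 e2 a)⁻¹ i 2)
        + (k * a - β * M2) • (fun i => (Emat l1 l2 x1 x2 e1 e2 a)⁻¹ i 3) := by
  ext i
  simp [bodyField, loads, Matrix.mulVec, dotProduct, Fin.sum_univ_four]
  ring

lemma drift_eq (l1 l2 x1 x2 e1 e2 k M1 M2 β : ℝ) (z : Fin 4 → ℝ) :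
    F0 l1 l2 x1 x2 e1 e2 k z + β • F2 l1 l2 x1 x2 e1 e2 M1 M2 z =
      Rtil (z 2) *ᵥ bodyField l1 l2 x1 x2 e1 e2 k M1 M2 β (z 3) := by
  rw [bodyField_eq, Matrix.mulVec_add, Matrix.mulVec_smul, Matrix.mulVec_smul]
  ext i
  simp only [F0, F2, X3, X4, Pi.add_apply, Pi.smul_apply, Pi.sub_apply, smul_eq_mul]
  ring

lemma Emat_mulVec_bodyField {l1 l2 x1 x2 e1 e2 : ℝ} (hl1 : 0 < l1) (hl2 : 0 < l2)
    (hx1 : 0 < x1) (hx2 : 0 < x2) (he1 : 0 < e1) (he2 : 0 < e2)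
    (k M1 M2 β a : ℝ) :
    Emat l1 l2 x1 x2 e1 e2 a *ᵥ bodyField l1 l2 x1 x2 e1 e2 k M1 M2 β a =
      loads k M1 M2 β a := by
  have := Emat_det_ne_zero hl1 hl2 hx1 hx2 he1 he2 a
  rw [bodyField, Matrix.mulVec_mulVec, Matrix.mul_nonsing_inv _ (isUnit_iff_ne_zero.2 this),
    Matrix.one_mulVec]

lemma contDiff_Emat_inv_apply {l1 l2 x1 x2 e1 e2 : ℝ} (hl1 : 0 < l1) (hl2 : 0 < l2)
    (hx1 : 0 < x1) (hx2 : 0 < x2) (he1 : 0 < e1) (he2 : 0 < e2)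
    {n : WithTop ℕ∞} (i j : Fin 4) :
    ContDiff ℝ n fun a => (Emat l1 l2 x1 x2 e1 e2 a)⁻¹ i j :=
  contDiff_matrix_inv (contDiff_Emat_apply l1 l2 x1 x2 e1 e2)
    (Emat_det_ne_zero hl1 hl2 hx1 hx2 he1 he2) i j

lemma contDiff_bodyField {l1 l2 x1 x2 e1 e2 : ℝ} (hl1 : 0 < l1) (hl2 : 0 < l2)
    (hx1 : 0 < x1) (hx2 : 0 < x2) (he1 : 0 < e1) (he2 : 0 < e2)
    (k M1 M2 β : ℝ) {n : WithTop ℕ∞} :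
    ContDiff ℝ n (bodyField l1 l2 x1 x2 e1 e2 k M1 M2 β) := by
  refine contDiff_pi.2 fun i => ?_
  have h2 := contDiff_Emat_inv_apply hl1 hl2 hx1 hx2 he1 he2 (n := n) i 2
  have h3 := contDiff_Emat_inv_apply hl1 hl2 hx1 hx2 he1 he2 (n := n) i 3
  have ha : ContDiff ℝ n fun a => -(β * (M1 * cos a + M2)) := by fun_prop
  have hb : ContDiff ℝ n fun a => k * a - β * M2 := by fun_prop
  simp only [bodyField_eq]
  exact (ha.mul h2).add (hb.mul h3)

lemma contDiff_drift {l1 l2 x1 x2 e1 e2 : ℝ} (hl1 : 0 < l1) (hl2 : 0 < l2)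
    (hx1 : 0 < x1) (hx2 : 0 < x2) (he1 : 0 < e1) (he2 : 0 < e2)
    (k M1 M2 β : ℝ) {n : WithTop ℕ∞} :
    ContDiff ℝ n fun z => F0 l1 l2 x1 x2 e1 e2 k z + β • F2 l1 l2 x1 x2 e1 e2 M1 M2 z := by
  simp only [drift_eq, Rtil_mulVec]
  have h := contDiff_pi.1 (contDiff_bodyField hl1 hl2 hx1 hx2 he1 he2 k M1 M2 β (n := n))
  have h' : ∀ i, ContDiff ℝ n fun z : Fin 4 → ℝ =>
      bodyField l1 l2 x1 x2 e1 e2 k M1 M2 β (z 3) i :=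
    fun i => (h i).comp (contDiff_apply ℝ ℝ 3)
  have h0 := h' 0
  have h1 := h' 1
  have h2 := h' 2
  have h3 := h' 3
  have hc : ContDiff ℝ n fun z : Fin 4 → ℝ => cos (z 2) := by fun_prop
  have hs : ContDiff ℝ n fun z : Fin 4 → ℝ => sin (z 2) := by fun_prop
  refine contDiff_pi.2 fun i => ?_
  fin_cases i
  · exact (hc.mul h0).sub (hs.mul h1)
  · exact (hs.mul h0).add (hc.mul h1)
  · exact h2
  · exact h3

lemma exists_norm_drift_le {l1 l2 x1 x2 e1 e2 : ℝ} (hl1 : 0 < l1) (hl2 : 0 < l2)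
    (hx1 : 0 < x1) (hx2 : 0 < x2) (he1 : 0 < e1) (he2 : 0 < e2)
    (k M1 M2 β : ℝ) :
    ∃ C : ℝ, ∀ z, ‖F0 l1 l2 x1 x2 e1 e2 k z + β • F2 l1 l2 x1 x2 e1 e2 M1 M2 z‖
      ≤ C * (1 + ‖z‖) := by
  have hcol : ∀ j : Fin 4, ∃ K : ℝ, 0 ≤ K ∧
      ∀ a, ‖fun i => (Emat l1 l2 x1 x2 e1 e2 a)⁻¹ i j‖ ≤ K := by
    intro j
    have hper : Function.Periodic (fun a => fun i => (Emat l1 l2 x1 x2 e1 e2 a)⁻¹ i j)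
        (2 * π) := fun a => by
      have : Emat l1 l2 x1 x2 e1 e2 (a + 2 * π) = Emat l1 l2 x1 x2 e1 e2 a := by
        simp only [Emat, cos_add_two_pi, sin_add_two_pi]
      simp only [this]
    obtain ⟨K, hK⟩ := (hper.isBounded_of_continuous two_pi_pos.ne' (continuous_pi fun i =>
      (contDiff_Emat_inv_apply hl1 hl2 hx1 hx2 he1 he2 (n := 0) i j).continuous)).exists_norm_le
    exact ⟨K, (norm_nonneg _).trans (hK _ ⟨0, rfl⟩), fun a => hK _ ⟨a, rfl⟩⟩
  obtain ⟨K2, hK20, hK2⟩ := hcol 2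
  obtain ⟨K3, hK30, hK3⟩ := hcol 3
  have hR : ∀ th (v : Fin 4 → ℝ), ‖Rtil th *ᵥ v‖ ≤ 2 * ‖v‖ := by
    intro th v
    have hv := fun i => norm_le_pi_norm v i
    have hb : ∀ r x y : ℝ, |r| ≤ 1 → |x| ≤ y → |r * x| ≤ y := fun r x y h1 h2 => by
      rw [abs_mul]
      nlinarith [abs_nonneg r, abs_nonneg x]
    simp only [Real.norm_eq_abs] at hv
    rw [Rtil_mulVec]
    refine (pi_norm_le_iff_of_nonneg (by positivity)).2 fun i => ?_
    have c0 := hb _ _ _ (abs_cos_le_one th) (hv 0)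
    have c1 := hb _ _ _ (abs_cos_le_one th) (hv 1)
    have s0 := hb _ _ _ (abs_sin_le_one th) (hv 0)
    have s1 := hb _ _ _ (abs_sin_le_one th) (hv 1)
    have v2 := hv 2
    have v3 := hv 3
    have := norm_nonneg v
    rw [Real.norm_eq_abs]
    fin_cases i
    · exact (abs_sub _ _).trans (by linarith)
    · exact (abs_add_le _ _).trans (by linarith)
    · exact v2.trans (by linarith)
    · exact v3.trans (by linarith)
  set P := |β| * (|M1| + |M2|) with hP
  set Q := |k| + |β| * |M2| with hQ
  have hP0 : 0 ≤ P := by positivity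
  refine ⟨2 * (P * K2 + Q * K3), fun z => ?_⟩
  rw [drift_eq]
  refine (hR _ _).trans ?_
  rw [mul_assoc]
  refine mul_le_mul_of_nonneg_left ?_ two_pos.le
  have hz : |z 3| ≤ ‖z‖ := norm_le_pi_norm z 3
  have hz0 := norm_nonneg z
  have h1 : ‖-(β * (M1 * cos (z 3) + M2))‖ ≤ P * (1 + ‖z‖) := by
    rw [norm_neg, Real.norm_eq_abs, abs_mul]
    have : |M1 * cos (z 3) + M2| ≤ |M1| + |M2| := by
      refine (abs_add_le _ _).trans ?_
      rw [abs_mul]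
      nlinarith [abs_cos_le_one (z 3), abs_nonneg M1]
    calc _ ≤ P := by rw [hP]; gcongr
      _ ≤ P * (1 + ‖z‖) := by nlinarith
  have h2 : ‖k * z 3 - β * M2‖ ≤ Q * (1 + ‖z‖) := by
    rw [Real.norm_eq_abs]
    refine (abs_sub _ _).trans ?_
    rw [abs_mul, abs_mul]
    have : |k| * |z 3| ≤ |k| * ‖z‖ := by gcongr
    have : 0 ≤ |β| * |M2| * ‖z‖ := by positivity
    have := abs_nonneg k
    rw [hQ]
    nlinarith
  rw [bodyField_eq]
  refine (norm_add_le _ _).trans ?_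
  rw [norm_smul, norm_smul]
  calc _ ≤ P * (1 + ‖z‖) * K2 + Q * (1 + ‖z‖) * K3 := by
        gcongr
        · exact hK2 _
        · exact hK3 _
    _ = _ := by ring

/-- Coefficient, along the relative angle, of the kernel vector of the first two rows of `Emat`
whose third component vanishes. -/
noncomputable def kerCoeff (l1 p q P Q a : ℝ) : ℝ :=
  2 / (P * l1) * ((P + Q) * cos a * ((p + q) * cos a) + (P + q) * sin a * ((p + Q) * sin a))

/-- Coefficient, along the relative angle, of the kernel vector of the first two rows of `Emat`
whose second component vanishes. -/
noncomputable def kerCoeff' (l1 l2 p q P a : ℝ) : ℝ :=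
  -(2 / (P * l1)) * ((P + q) * sin a * (p * l2 / 2 * sin a)
    + P * (l1 + l2 * cos a) / 2 * ((p + q) * cos a))

/-- First coefficient of the linear relation satisfied by singular covectors. -/
noncomputable def obstr (l1 l2 p q P Q a : ℝ) : ℝ :=
  kerCoeff l1 p q P Q a *
      ((p + q) * sin a * (p * l2 / 2 * sin a) + p * l2 / 2 * cos a * ((p + q) * cos a))
    + kerCoeff' l1 l2 p q P a *
      ((p + q) * sin a * ((p + Q) * sin a) + (p + Q) * cos a * ((p + q) * cos a))
    + (p + q) * cos a * (((p + q) * cos a) ^ 2 + ((p + Q) * sin a) ^ 2)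

/-- Second coefficient of the linear relation satisfied by singular covectors. -/
noncomputable def obstr' (l1 l2 p q P Q a : ℝ) : ℝ :=
  kerCoeff l1 p q P Q a *
      ((P + q) * cos a * (p * l2 / 2 * sin a) - P * l2 / 2 * sin a * ((p + q) * cos a))
    + kerCoeff' l1 l2 p q P a *
      ((P + q) * cos a * ((p + Q) * sin a) - (P + Q) * sin a * ((p + q) * cos a))
    - (P + q) * sin a * ((p + q) * cos a) ^ 2
    + (P + Q) * cos a * ((p + q) * cos a) * ((p + Q) * sin a)

lemma contDiff_obstr (l1 l2 p q P Q : ℝ) {n : WithTop ℕ∞} :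
    ContDiff ℝ n (obstr l1 l2 p q P Q) := by
  unfold obstr kerCoeff kerCoeff'
  fun_prop

lemma contDiff_obstr' (l1 l2 p q P Q : ℝ) {n : WithTop ℕ∞} :
    ContDiff ℝ n (obstr' l1 l2 p q P Q) := by
  unfold obstr' kerCoeff kerCoeff'
  fun_prop

lemma obstr_zero {l1 P : ℝ} (hl1 : l1 ≠ 0) (hP : P ≠ 0) (l2 p q Q : ℝ) :
    obstr l1 l2 p q P Q 0 =
      -((p + q) ^ 2 / (P * l1)) * (P * l1 * (Q - q) + Q * l2 * (P - p)) := by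
  simp only [obstr, kerCoeff, kerCoeff', sin_zero, cos_zero]
  field_simp
  ring

lemma obstr'_zero (l1 l2 p q P Q : ℝ) : obstr' l1 l2 p q P Q 0 = 0 := by
  simp [obstr']

lemma obstr_relation {l1 l2 p q P Q a m0 m1 m0' m1' g0 g1 g2 g3 μ0 μ1 : ℝ}
    (hl1 : l1 ≠ 0) (hP : P ≠ 0) (hg : g1 ≠ 0 ∨ g2 ≠ 0)
    (h0 : -(p + q) * cos a * g0 - (p + Q) * sin a * g1 + p * l2 / 2 * sin a * g2 = 0)
    (h1 : (P + q) * sin a * g0 - (P + Q) * cos a * g1 + P * (l1 + l2 * cos a) / 2 * g2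
      + P * l1 / 2 * g3 = 0)
    (hμ0 : μ0 = -(p + q) * cos a * m0 + (P + q) * sin a * m1)
    (hμ1 : μ1 = -(p + Q) * sin a * m0 - (P + Q) * cos a * m1)
    (e0 : -(p + q) * cos a * m0' + (P + q) * sin a * m1'
      + g3 * (m0 * ((p + q) * sin a) + m1 * ((P + q) * cos a)) = g2 * μ1)
    (e1 : -(p + Q) * sin a * m0' - (P + Q) * cos a * m1'
      + g3 * (-(p + Q) * cos a * m0 + (P + Q) * sin a * m1) = -(g2 * μ0))
    (e2 : p * l2 / 2 * sin a * m0' + P * (l1 + l2 * cos a) / 2 * m1'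
      + g3 * (p * l2 / 2 * cos a * m0 - P * l2 / 2 * sin a * m1) = μ0 * g1 - μ1 * g0)
    (e3 : m1' * (P * l1 / 2) =
      m0 * ((p + q) * sin a * g0 - (p + Q) * cos a * g1 + p * l2 / 2 * cos a * g2)
      + m1 * ((P + q) * cos a * g0 + (P + Q) * sin a * g1 - P * l2 / 2 * sin a * g2)) :
    obstr l1 l2 p q P Q a * m0 + obstr' l1 l2 p q P Q a * m1 = 0 := by
  obtain ⟨A, hA⟩ : ∃ A, A = kerCoeff l1 p q P Q a := ⟨_, rfl⟩
  obtain ⟨B, hB⟩ : ∃ B, B = kerCoeff' l1 l2 p q P a := ⟨_, rfl⟩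
  have hA' : P * l1 / 2 * A =
      (P + Q) * cos a * ((p + q) * cos a) + (P + q) * sin a * ((p + Q) * sin a) := by
    rw [hA, kerCoeff]; field_simp
  have hB' : P * l1 / 2 * B = -((P + q) * sin a * (p * l2 / 2 * sin a)
      + P * (l1 + l2 * cos a) / 2 * ((p + q) * cos a)) := by
    rw [hB, kerCoeff']; field_simp
  rw [obstr, obstr', ← hA, ← hB]
  generalize cos a = c at *
  generalize sin a = s at *
  clear hA hB
  have hg0 : (p + q) * c * g0 = -(p + Q) * s * g1 + p * l2 / 2 * s * g2 := by linarith
  have hg3 : (p + q) * c * g3 = A * g1 + B * g2 := by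
    have : P * l1 / 2 ≠ 0 := by positivity
    apply mul_left_cancel₀ this
    linear_combination (p + q) * c * h1 - (P + q) * s * hg0 - g1 * hA' - g2 * hB'
  subst hμ0 hμ1
  rcases hg with hg | hg <;> apply mul_left_cancel₀ hg <;> rw [mul_zero]
  · linear_combination
      (p + q) * c * (p * l2 / 2 * s * e0 + (p + q) * c * e2 + B * e3)
      - (m0 * ((p + q) * s * (p * l2 / 2 * s) + p * l2 / 2 * c * ((p + q) * c))
        + m1 * ((P + q) * c * (p * l2 / 2 * s) - P * l2 / 2 * s * ((p + q) * c))) * hg3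
      - (p + q) * c * m1' * hB'
      + (B * (m0 * ((p + q) * s) + m1 * ((P + q) * c))
        - (p + q) * c * (-(p + Q) * s * m0 - (P + Q) * c * m1)) * hg0
  · linear_combination
      -((p + q) * c) * (-(p + Q) * s * e0 + (p + q) * c * e1 + A * e3)
      + (m0 * ((p + q) * s * (-(p + Q) * s) - (p + Q) * c * ((p + q) * c))
        + m1 * ((P + q) * c * (-(p + Q) * s) + (P + Q) * s * ((p + q) * c))) * hg3
      + (p + q) * c * m1' * hA'
      - A * (m0 * ((p + q) * s) + m1 * ((P + q) * c)) * hg0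

/-- The linear form in the velocity that vanishes along the reference trajectory as long as
that trajectory admits a singular covector. -/
noncomputable def tangentForm (l1 l2 p q P Q a : ℝ) (g : Fin 4 → ℝ) : ℝ :=
  let C := obstr l1 l2 p q P Q a
  let C' := obstr' l1 l2 p q P Q a
  let D := 2 / (P * l1) *
    (-C' * ((p + q) * sin a * g 0 - (p + Q) * cos a * g 1 + p * l2 / 2 * cos a * g 2)
      + C * ((P + q) * cos a * g 0 + (P + Q) * sin a * g 1 - P * l2 / 2 * sin a * g 2))
  C * (-((p + q) * sin a * g 3 * C') + (P + q) * (sin a * D + cos a * g 3 * C)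
      - g 2 * ((p + Q) * sin a * C' - (P + Q) * cos a * C))
    + (p + q) * cos a * (C' * D
      + g 3 * (deriv (obstr' l1 l2 p q P Q) a * C - deriv (obstr l1 l2 p q P Q) a * C'))

lemma tangentForm_add (l1 l2 p q P Q a : ℝ) (g h : Fin 4 → ℝ) :
    tangentForm l1 l2 p q P Q a (g + h) =
      tangentForm l1 l2 p q P Q a g + tangentForm l1 l2 p q P Q a h := by
  simp only [tangentForm, Pi.add_apply]
  ring

lemma tangentForm_smul (l1 l2 p q P Q a r : ℝ) (g : Fin 4 → ℝ) :
    tangentForm l1 l2 p q P Q a (r • g) = r * tangentForm l1 l2 p q P Q a g := by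
  simp only [tangentForm, Pi.smul_apply, smul_eq_mul]
  ring

lemma continuous_tangentForm (l1 l2 p q P Q : ℝ) {g : ℝ → Fin 4 → ℝ}
    (hg : ∀ i, Continuous fun a => g a i) :
    Continuous fun a => tangentForm l1 l2 p q P Q a (g a) := by
  have h1 : Continuous (obstr l1 l2 p q P Q) := (contDiff_obstr l1 l2 p q P Q (n := 0)).continuous
  have h2 : Continuous (obstr' l1 l2 p q P Q) :=
    (contDiff_obstr' l1 l2 p q P Q (n := 0)).continuous
  have h3 : Continuous (deriv (obstr l1 l2 p q P Q)) :=
    (contDiff_obstr l1 l2 p q P Q (n := 1)).continuous_deriv le_rfl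
  have h4 : Continuous (deriv (obstr' l1 l2 p q P Q)) :=
    (contDiff_obstr' l1 l2 p q P Q (n := 1)).continuous_deriv le_rfl
  have g0 := hg 0
  have g1 := hg 1
  have g2 := hg 2
  have g3 := hg 3
  simp only [tangentForm]
  fun_prop

lemma tangentForm_eq_zero {l1 l2 p q P Q : ℝ} {S : Set ℝ} {α : ℝ → ℝ} {μ g : ℝ → Fin 4 → ℝ}
    (hS : IsOpen S) (hl1 : l1 ≠ 0) (hP : P ≠ 0) (hpq : p + q ≠ 0)
    (hcos : ∀ t ∈ S, cos (α t) ≠ 0) (hobs : ∀ t ∈ S, obstr l1 l2 p q P Q (α t) ≠ 0)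
    (hg : ∀ t ∈ S, g t 1 ≠ 0 ∨ g t 2 ≠ 0)
    (h0 : ∀ t ∈ S, -(p + q) * cos (α t) * g t 0 - (p + Q) * sin (α t) * g t 1
      + p * l2 / 2 * sin (α t) * g t 2 = 0)
    (h1 : ∀ t ∈ S, (P + q) * sin (α t) * g t 0 - (P + Q) * cos (α t) * g t 1
      + P * (l1 + l2 * cos (α t)) / 2 * g t 2 + P * l1 / 2 * g t 3 = 0)
    (hα : ∀ t ∈ S, HasDerivAt α (g t 3) t)
    (hμ0 : ∀ t ∈ S, HasDerivAt (fun t => μ t 0) (g t 2 * μ t 1) t)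
    (hμ1 : ∀ t ∈ S, HasDerivAt (fun t => μ t 1) (-(g t 2 * μ t 0)) t)
    (hμ2 : ∀ t ∈ S, HasDerivAt (fun t => μ t 2) (μ t 0 * g t 1 - μ t 1 * g t 0) t)
    (hμ : ∀ t ∈ S, μ t ≠ 0)
    (hrel : ∀ t ∈ S, ∃ m0 m1 : ℝ,
      μ t 0 = -(p + q) * cos (α t) * m0 + (P + q) * sin (α t) * m1 ∧
      μ t 1 = -(p + Q) * sin (α t) * m0 - (P + Q) * cos (α t) * m1 ∧
      μ t 2 = p * l2 / 2 * sin (α t) * m0 + P * (l1 + l2 * cos (α t)) / 2 * m1 ∧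
      μ t 3 = P * l1 / 2 * m1 ∧
      HasDerivAt (fun t => μ t 3)
        (m0 * ((p + q) * sin (α t) * g t 0 - (p + Q) * cos (α t) * g t 1
            + p * l2 / 2 * cos (α t) * g t 2)
          + m1 * ((P + q) * cos (α t) * g t 0 + (P + Q) * sin (α t) * g t 1
            - P * l2 / 2 * sin (α t) * g t 2)) t) :
    ∀ t ∈ S, tangentForm l1 l2 p q P Q (α t) (g t) = 0 := by
  have hPl : P * l1 / 2 ≠ 0 := by positivity
  obtain ⟨m1, hm1⟩ : ∃ m1 : ℝ → ℝ, m1 = fun t => μ t 3 / (P * l1 / 2) := ⟨_, rfl⟩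
  obtain ⟨m0, hm0⟩ : ∃ m0 : ℝ → ℝ, m0 = fun t =>
    ((P + q) * sin (α t) * m1 t - μ t 0) / ((p + q) * cos (α t)) := ⟨_, rfl⟩
  have key : ∀ t ∈ S,
      μ t 0 = -(p + q) * cos (α t) * m0 t + (P + q) * sin (α t) * m1 t ∧
      μ t 1 = -(p + Q) * sin (α t) * m0 t - (P + Q) * cos (α t) * m1 t ∧
      μ t 2 = p * l2 / 2 * sin (α t) * m0 t + P * (l1 + l2 * cos (α t)) / 2 * m1 t ∧
      μ t 3 = P * l1 / 2 * m1 t ∧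
      HasDerivAt (fun t => μ t 3)
        (m0 t * ((p + q) * sin (α t) * g t 0 - (p + Q) * cos (α t) * g t 1
            + p * l2 / 2 * cos (α t) * g t 2)
          + m1 t * ((P + q) * cos (α t) * g t 0 + (P + Q) * sin (α t) * g t 1
            - P * l2 / 2 * sin (α t) * g t 2)) t := by
    intro t ht
    obtain ⟨n0, n1, r0, r1, r2, r3, r4⟩ := hrel t ht
    have hd : (p + q) * cos (α t) ≠ 0 := mul_ne_zero hpq (hcos t ht)
    have e1 : m1 t = n1 := by
      rw [hm1]
      exact (div_eq_iff hPl).2 (by rw [r3]; ring)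
    have e0 : m0 t = n0 := by
      rw [hm0]
      refine (div_eq_iff hd).2 ?_
      rw [r0, e1]
      ring
    rw [e0, e1]
    exact ⟨r0, r1, r2, r3, r4⟩
  have d1 : ∀ t ∈ S, ∃ r, HasDerivAt m1 r t := fun t ht => by
    rw [hm1]
    exact ⟨_, (key t ht).2.2.2.2.div_const _⟩
  have d0 : ∀ t ∈ S, ∃ r, HasDerivAt m0 r t := fun t ht => by
    obtain ⟨r, hr⟩ := d1 t ht
    have hd : (p + q) * cos (α t) ≠ 0 := mul_ne_zero hpq (hcos t ht)
    rw [hm0]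
    exact ⟨_, ((((hα t ht).sin.const_mul (P + q)).mul hr).sub (hμ0 t ht)).div
      ((hα t ht).cos.const_mul (p + q)) hd⟩
  have eqs : ∀ t ∈ S, ∃ n0 n1, HasDerivAt m0 n0 t ∧ HasDerivAt m1 n1 t ∧
      -(p + q) * cos (α t) * n0 + (P + q) * sin (α t) * n1
        + g t 3 * (m0 t * ((p + q) * sin (α t)) + m1 t * ((P + q) * cos (α t)))
        = g t 2 * μ t 1 ∧
      n1 * (P * l1 / 2) = m0 t * ((p + q) * sin (α t) * g t 0 - (p + Q) * cos (α t) * g t 1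
            + p * l2 / 2 * cos (α t) * g t 2)
          + m1 t * ((P + q) * cos (α t) * g t 0 + (P + Q) * sin (α t) * g t 1
            - P * l2 / 2 * sin (α t) * g t 2) ∧
      obstr l1 l2 p q P Q (α t) * m0 t + obstr' l1 l2 p q P Q (α t) * m1 t = 0 := by
    intro t ht
    obtain ⟨n0, hn0⟩ := d0 t ht
    obtain ⟨n1, hn1⟩ := d1 t ht
    have hs := (hα t ht).sin
    have hc := (hα t ht).cos
    have near := hS.mem_nhds ht
    have e0 := ((hμ0 t ht).congr_of_eventuallyEq
      (Filter.eventually_of_mem near fun u hu => (key u hu).1.symm)).unique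
      (((hc.const_mul (-(p + q))).mul hn0).add ((hs.const_mul (P + q)).mul hn1))
    have e1 := ((hμ1 t ht).congr_of_eventuallyEq
      (Filter.eventually_of_mem near fun u hu => (key u hu).2.1.symm)).unique
      (((hs.const_mul (-(p + Q))).mul hn0).sub ((hc.const_mul (P + Q)).mul hn1))
    have e2 := ((hμ2 t ht).congr_of_eventuallyEq
      (Filter.eventually_of_mem near fun u hu => (key u hu).2.2.1.symm)).unique
      (((hs.const_mul (p * l2 / 2)).mul hn0).add
        (((((hc.const_mul l2).const_add l1).const_mul P).div_const 2).mul hn1))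
    have e3 := ((key t ht).2.2.2.2.congr_of_eventuallyEq
      (Filter.eventually_of_mem near fun u hu => (key u hu).2.2.2.1.symm)).unique
      (hn1.const_mul (P * l1 / 2))
    have E0 : -(p + q) * cos (α t) * n0 + (P + q) * sin (α t) * n1
        + g t 3 * (m0 t * ((p + q) * sin (α t)) + m1 t * ((P + q) * cos (α t)))
        = g t 2 * μ t 1 := by linear_combination -e0
    have E3 := (mul_comm _ _).trans e3.symm
    refine ⟨n0, n1, hn0, hn1, E0, E3, ?_⟩
    exact obstr_relation hl1 hP (hg t ht) (h0 t ht) (h1 t ht) (key t ht).1 (key t ht).2.1 E0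
      (by linear_combination -e1) (by linear_combination -e2) E3
  intro t ht
  obtain ⟨n0, n1, hn0, hn1, E0, E3, E⟩ := eqs t ht
  have hC := (((contDiff_obstr l1 l2 p q P Q (n := 1)).differentiable one_ne_zero
    (α t)).hasDerivAt.comp t (hα t ht)).mul hn0
  have hC' := (((contDiff_obstr' l1 l2 p q P Q (n := 1)).differentiable one_ne_zero
    (α t)).hasDerivAt.comp t (hα t ht)).mul hn1
  have E' := (hC.add hC').unique ((hasDerivAt_const t (0 : ℝ)).congr_of_eventuallyEq
    (Filter.eventually_of_mem (hS.mem_nhds ht) fun u hu => by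
      obtain ⟨-, -, -, -, -, -, h⟩ := eqs u hu
      exact h))
  obtain ⟨k0, k1, -, k3, -⟩ := key t ht
  have k2 := (key t ht).2.2.1
  have hne := hμ t ht
  have ho := hobs t ht
  simp only [Function.comp_apply] at E'
  rw [tangentForm]
  generalize obstr l1 l2 p q P Q (α t) = C at *
  generalize obstr' l1 l2 p q P Q (α t) = C' at *
  have hm : m1 t ≠ 0 := by
    intro h
    have h' : m0 t = 0 := by simpa [h, ho] using E
    refine hne ?_
    ext i
    fin_cases i
    · simpa [h, h'] using k0
    · simpa [h, h'] using k1
    · simpa [h, h'] using k2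
    · simpa [h] using k3
  obtain ⟨r, hr⟩ : ∃ r, m1 t = C * r := ⟨m1 t / C, by field_simp⟩
  have hr0 : m0 t = -C' * r := by
    apply mul_left_cancel₀ ho
    linear_combination E - C' * hr
  have hrne : r ≠ 0 := by
    rintro rfl
    exact hm (by rw [hr, mul_zero])
  rw [hr, hr0] at E0 E3 E' k1
  obtain ⟨D, hD⟩ : ∃ D, D = 2 / (P * l1) *
    (-C' * ((p + q) * sin (α t) * g t 0 - (p + Q) * cos (α t) * g t 1
        + p * l2 / 2 * cos (α t) * g t 2)
      + C * ((P + q) * cos (α t) * g t 0 + (P + Q) * sin (α t) * g t 1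
        - P * l2 / 2 * sin (α t) * g t 2)) := ⟨_, rfl⟩
  have hDr : n1 = r * D := by
    apply mul_right_cancel₀ hPl
    rw [E3, hD]
    field_simp
  simp only [← hD]
  rw [k1, hDr] at E0
  rw [hDr] at E'
  apply mul_left_cancel₀ hrne
  linear_combination (p + q) * cos (α t) * E' + C * E0

lemma hasDerivAt_bodyField {l1 l2 x1 x2 e1 e2 : ℝ} (hl1 : 0 < l1) (hl2 : 0 < l2)
    (hx1 : 0 < x1) (hx2 : 0 < x2) (he1 : 0 < e1) (he2 : 0 < e2)
    (k M1 M2 β a : ℝ) (i : Fin 4) :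
    HasDerivAt (fun a => bodyField l1 l2 x1 x2 e1 e2 k M1 M2 β a i)
      (deriv (bodyField l1 l2 x1 x2 e1 e2 k M1 M2 β) a i) a :=
  hasDerivAt_pi.1 (((contDiff_bodyField hl1 hl2 hx1 hx2 he1 he2 k M1 M2 β (n := 1)).differentiable
    one_ne_zero a).hasDerivAt) i

lemma fderiv_drift_apply {l1 l2 x1 x2 e1 e2 : ℝ} (hl1 : 0 < l1) (hl2 : 0 < l2)
    (hx1 : 0 < x1) (hx2 : 0 < x2) (he1 : 0 < e1) (he2 : 0 < e2)
    (k M1 M2 β : ℝ) (z v : Fin 4 → ℝ) :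
    fderiv ℝ (fun z => F0 l1 l2 x1 x2 e1 e2 k z + β • F2 l1 l2 x1 x2 e1 e2 M1 M2 z) z v =
      let g := bodyField l1 l2 x1 x2 e1 e2 k M1 M2 β (z 3)
      let g' := deriv (bodyField l1 l2 x1 x2 e1 e2 k M1 M2 β) (z 3)
      ![cos (z 2) * (v 3 * g' 0 - v 2 * g 1) - sin (z 2) * (v 2 * g 0 + v 3 * g' 1),
        sin (z 2) * (v 3 * g' 0 - v 2 * g 1) + cos (z 2) * (v 2 * g 0 + v 3 * g' 1),
        v 3 * g' 2, v 3 * g' 3] := by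
  have hd := ((contDiff_drift hl1 hl2 hx1 hx2 he1 he2 k M1 M2 β (n := 1)).differentiable
    one_ne_zero z).hasFDerivAt
  have hline : HasDerivAt (fun s : ℝ => z + s • v) v 0 := by
    simpa using ((hasDerivAt_id (0 : ℝ)).smul_const v).const_add z
  have hz : z + (0 : ℝ) • v = z := by simp
  rw [← hz] at hd
  refine ((hd.comp_hasDerivAt (0 : ℝ) hline).congr_deriv (by rw [hz])).unique ?_
  have hcoord : ∀ i, HasDerivAt (fun s : ℝ => z i + s * v i) (v i) 0 := fun i => by
    simpa using ((hasDerivAt_id (0 : ℝ)).mul_const (v i)).const_add (z i)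
  have hg : ∀ i, HasDerivAt
      (fun s : ℝ => bodyField l1 l2 x1 x2 e1 e2 k M1 M2 β (z 3 + s * v 3) i)
      (deriv (bodyField l1 l2 x1 x2 e1 e2 k M1 M2 β) (z 3) i * v 3) 0 := fun i => by
    have h := hasDerivAt_bodyField hl1 hl2 hx1 hx2 he1 he2 k M1 M2 β (z 3 + 0 * v 3) i
    have := h.comp (0 : ℝ) (hcoord 3)
    refine this.congr_deriv ?_
    simp
  have hc := (hcoord 2).cos
  have hs := (hcoord 2).sin
  have e : ((fun z => F0 l1 l2 x1 x2 e1 e2 k z + β • F2 l1 l2 x1 x2 e1 e2 M1 M2 z) ∘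
      fun s : ℝ => z + s • v) = fun s => Rtil (z 2 + s * v 2) *ᵥ
        bodyField l1 l2 x1 x2 e1 e2 k M1 M2 β (z 3 + s * v 3) := by
    ext1 s
    simp [drift_eq]
  rw [e]
  simp only [Rtil_mulVec]
  refine hasDerivAt_pi.2 fun i => ?_
  fin_cases i
  · refine ((hc.mul (hg 0)).sub (hs.mul (hg 1))).congr_deriv ?_
    simp
    ring
  · refine ((hs.mul (hg 0)).add (hc.mul (hg 1))).congr_deriv ?_
    simp
    ring
  · refine (hg 2).congr_deriv ?_
    simp [mul_comm]
  · refine (hg 3).congr_deriv ?_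
    simp [mul_comm]

/-- The adjoint equation along an integral curve of the drift, in the body frame. -/
lemma exists_body_adjoint {l1 l2 x1 x2 e1 e2 : ℝ} (hl1 : 0 < l1) (hl2 : 0 < l2)
    (hx1 : 0 < x1) (hx2 : 0 < x2) (he1 : 0 < e1) (he2 : 0 < e2)
    {k M1 M2 β : ℝ} {z : ℝ → Fin 4 → ℝ} {S : Set ℝ}
    {p : ℝ → (Fin 4 → ℝ) →L[ℝ] ℝ}
    (hz : ∀ t ∈ S, HasDerivAt z
      (F0 l1 l2 x1 x2 e1 e2 k (z t) + β • F2 l1 l2 x1 x2 e1 e2 M1 M2 (z t)) t)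
    (hp : ∀ t ∈ S, HasDerivAt p (-(p t).comp (fderiv ℝ
      (fun z => F0 l1 l2 x1 x2 e1 e2 k z + β • F2 l1 l2 x1 x2 e1 e2 M1 M2 z) (z t))) t) :
    ∃ μ : ℝ → Fin 4 → ℝ, (∀ t v, p t (Rtil (z t 2) *ᵥ v) = μ t ⬝ᵥ v) ∧ ∀ t ∈ S,
      let g := bodyField l1 l2 x1 x2 e1 e2 k M1 M2 β (z t 3)
      HasDerivAt (fun t => μ t 0) (g 2 * μ t 1) t ∧
      HasDerivAt (fun t => μ t 1) (-(g 2 * μ t 0)) t ∧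
      HasDerivAt (fun t => μ t 2) (μ t 0 * g 1 - μ t 1 * g 0) t ∧
      HasDerivAt (fun t => μ t 3)
        (-(μ t ⬝ᵥ deriv (bodyField l1 l2 x1 x2 e1 e2 k M1 M2 β) (z t 3))) t := by
  obtain ⟨L, hL⟩ : ∃ L : ℝ → Fin 4 → ℝ, L = fun t i => p t (Pi.single i 1) := ⟨_, rfl⟩
  have hpL : ∀ t v, p t v = L t 0 * v 0 + L t 1 * v 1 + L t 2 * v 2 + L t 3 * v 3 := by
    intro t v
    have : v = ∑ i, v i • Pi.single i (1 : ℝ) := by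
      ext j
      simp [Finset.sum_apply, Pi.single_apply]
    conv_lhs => rw [this]
    simp only [Fin.sum_univ_four, map_add, map_smul, smul_eq_mul, hL]
    ring
  refine ⟨fun t => ![cos (z t 2) * L t 0 + sin (z t 2) * L t 1,
    -sin (z t 2) * L t 0 + cos (z t 2) * L t 1, L t 2, L t 3], fun t v => ?_, fun t ht => ?_⟩
  · rw [hpL, Rtil_mulVec]
    simp [dotProduct, Fin.sum_univ_four]
    ring
  have hz2 : HasDerivAt (fun t => z t 2)
      (bodyField l1 l2 x1 x2 e1 e2 k M1 M2 β (z t 3) 2) t := by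
    have := hasDerivAt_pi.1 (hz t ht) 2
    rwa [drift_eq, Rtil_mulVec] at this
  have hLd : ∀ i, HasDerivAt (fun t => L t i) (-(p t) (fderiv ℝ
      (fun z => F0 l1 l2 x1 x2 e1 e2 k z + β • F2 l1 l2 x1 x2 e1 e2 M1 M2 z) (z t)
      (Pi.single i 1))) t := fun i => by
    rw [hL]
    simpa using (hp t ht).clm_apply (hasDerivAt_const t (Pi.single i (1 : ℝ)))
  simp only [fderiv_drift_apply hl1 hl2 hx1 hx2 he1 he2, hpL] at hLd
  have h0 := hLd 0
  have h1 := hLd 1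
  have h2 := hLd 2
  have h3 := hLd 3
  simp at h0 h1 h2 h3
  have hc := hz2.cos
  have hs := hz2.sin
  refine ⟨?_, ?_, ?_, ?_⟩
  · refine ((hc.mul h0).add (hs.mul h1)).congr_deriv ?_
    simp
    ring
  · refine ((hs.neg.mul h0).add (hc.mul h1)).congr_deriv ?_
    simp
    ring
  · refine h2.congr_deriv ?_
    simp
    ring
  · refine h3.congr_deriv ?_
    simp [dotProduct, Fin.sum_univ_four]
    ring

lemma bodyField_rows {l1 l2 x1 x2 e1 e2 : ℝ} (hl1 : 0 < l1) (hl2 : 0 < l2)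
    (hx1 : 0 < x1) (hx2 : 0 < x2) (he1 : 0 < e1) (he2 : 0 < e2)
    (k M1 M2 β a : ℝ) :
    let g := bodyField l1 l2 x1 x2 e1 e2 k M1 M2 β a;
    -(x1*l1 + x2*l2) * cos a * g 0 - (x1*l1 + e2*l2) * sin a * g 1
      + x1*l1*l2/2 * sin a * g 2 = 0 ∧
    (e1*l1 + x2*l2) * sin a * g 0 - (e1*l1 + e2*l2) * cos a * g 1
      + e1*l1*(l1 + l2*cos a)/2 * g 2 + e1*l1*l1/2 * g 3 = 0 ∧
    -((1/2)*e2*l2^2) * g 1 - e2*l2^2*((1/12)*l2) * g 2 = k * a - β * M2 := by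
  have h := Emat_mulVec_bodyField hl1 hl2 hx1 hx2 he1 he2 k M1 M2 β a
  rw [Emat_mulVec] at h
  have h0 := congrFun h 0
  have h1 := congrFun h 1
  have h3 := congrFun h 3
  simp only [Matrix.cons_val, loads] at h0 h1 h3
  exact ⟨by linear_combination h0, by linear_combination h1, h3⟩

lemma bodyField_rows_deriv {l1 l2 x1 x2 e1 e2 : ℝ} (hl1 : 0 < l1) (hl2 : 0 < l2)
    (hx1 : 0 < x1) (hx2 : 0 < x2) (he1 : 0 < e1) (he2 : 0 < e2)
    (k M1 M2 β a : ℝ) :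
    let g := bodyField l1 l2 x1 x2 e1 e2 k M1 M2 β a;
    let g' := deriv (bodyField l1 l2 x1 x2 e1 e2 k M1 M2 β) a;
    (-(x1*l1 + x2*l2) * cos a * g' 0 - (x1*l1 + e2*l2) * sin a * g' 1
        + x1*l1*l2/2 * sin a * g' 2
      = -((x1*l1 + x2*l2) * sin a * g 0 - (x1*l1 + e2*l2) * cos a * g 1
        + x1*l1*l2/2 * cos a * g 2)) ∧
    ((e1*l1 + x2*l2) * sin a * g' 0 - (e1*l1 + e2*l2) * cos a * g' 1
        + e1*l1*(l1 + l2*cos a)/2 * g' 2 + e1*l1*l1/2 * g' 3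
      = -((e1*l1 + x2*l2) * cos a * g 0 + (e1*l1 + e2*l2) * sin a * g 1
        - e1*l1*l2/2 * sin a * g 2)) := by
  have hr := bodyField_rows hl1 hl2 hx1 hx2 he1 he2 k M1 M2 β
  have hd := hasDerivAt_bodyField hl1 hl2 hx1 hx2 he1 he2 k M1 M2 β a
  have hc := hasDerivAt_cos a
  have hs := hasDerivAt_sin a
  have e0 := ((((hc.const_mul (-(x1*l1 + x2*l2))).mul (hd 0)).sub
    ((hs.const_mul (x1*l1 + e2*l2)).mul (hd 1))).add
    ((hs.const_mul (x1*l1*l2/2)).mul (hd 2))).unique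
    ((hasDerivAt_const a (0 : ℝ)).congr_of_eventuallyEq (Filter.Eventually.of_forall
      fun b => (hr b).1))
  have e1 := (((((hs.const_mul (e1*l1 + x2*l2)).mul (hd 0)).sub
    ((hc.const_mul (e1*l1 + e2*l2)).mul (hd 1))).add
    (((((hc.const_mul l2).const_add l1).const_mul (e1*l1)).div_const 2).mul (hd 2))).add
    ((hd 3).const_mul (e1*l1*l1/2))).unique
    ((hasDerivAt_const a (0 : ℝ)).congr_of_eventuallyEq (Filter.Eventually.of_forall
      fun b => (hr b).2.1))
  exact ⟨by linear_combination e0, by linear_combination e1⟩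

lemma eventually_tangentForm_eq_zero {l1 l2 x1 x2 e1 e2 : ℝ} (hl1 : 0 < l1) (hl2 : 0 < l2)
    (hx1 : 0 < x1) (hx2 : 0 < x2) (he1 : 0 < e1) (he2 : 0 < e2)
    {k M1 M2 β τ : ℝ} (hβ : 0 < β) (hM1 : M1 ≠ 0) (hM2 : M2 ≠ 0)
    (hτ : 0 < τ) {z : ℝ → Fin 4 → ℝ} {p : ℝ → (Fin 4 → ℝ) →L[ℝ] ℝ} (hz0 : z 0 3 = 0)
    (hz : ∀ t, HasDerivAt z
      (F0 l1 l2 x1 x2 e1 e2 k (z t) + β • F2 l1 l2 x1 x2 e1 e2 M1 M2 (z t)) t)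
    (hp : ∀ t ∈ Icc 0 τ, p t ≠ 0 ∧ HasDerivAt p (-(p t).comp (fderiv ℝ
        (fun z => F0 l1 l2 x1 x2 e1 e2 k z + β • F2 l1 l2 x1 x2 e1 e2 M1 M2 z) (z t))) t ∧
      p t (F1 l1 l2 x1 x2 e1 e2 M1 (z t)) = 0 ∧ p t (F2 l1 l2 x1 x2 e1 e2 M1 M2 (z t)) = 0)
    (hobs : obstr l1 l2 (x1*l1) (x2*l2) (e1*l1) (e2*l2) 0 ≠ 0)
    (hrate : bodyField l1 l2 x1 x2 e1 e2 k M1 M2 β 0 3 ≠ 0) :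
    ∃ δ > 0, ∀ t ∈ Ioo 0 δ, tangentForm l1 l2 (x1*l1) (x2*l2) (e1*l1) (e2*l2) (z t 3)
      (bodyField l1 l2 x1 x2 e1 e2 k M1 M2 β (z t 3)) = 0 := by
  have hα : ∀ t, HasDerivAt (fun t => z t 3)
      (bodyField l1 l2 x1 x2 e1 e2 k M1 M2 β (z t 3) 3) t := fun t => by
    have := hasDerivAt_pi.1 (hz t) 3
    rwa [drift_eq, Rtil_mulVec] at this
  have hcont : Filter.Tendsto (fun t => z t 3) (nhdsWithin 0 (Ioi 0)) (nhds 0) := by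
    have := (hα 0).continuousAt.tendsto
    rw [hz0] at this
    exact this.mono_left nhdsWithin_le_nhds
  have near : ∀ {f : ℝ → ℝ}, Continuous f → f 0 ≠ 0 →
      ∀ᶠ t in nhdsWithin 0 (Ioi 0), f (z t 3) ≠ 0 := fun {f} hf h0 =>
    (((hf.tendsto 0).comp hcont).eventually_ne h0)
  have hsin : ∀ᶠ t in nhdsWithin (0 : ℝ) (Ioi 0), sin (z t 3) ≠ 0 := by
    have h := (hα 0).sin.eventually_ne (c := 0) (by simpa [hz0] using hrate)
    exact h.filter_mono (nhdsWithin_mono _ fun t ht => ne_of_gt ht)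
  have hcos := near continuous_cos (by simp)
  have hob := near (contDiff_obstr l1 l2 (x1*l1) (x2*l2) (e1*l1) (e2*l2) (n := 0)).continuous hobs
  have hb := near (f := fun a => k * a - β * M2) (by fun_prop) (by simp [hβ.ne', hM2])
  have hτ' : ∀ᶠ t in nhdsWithin (0 : ℝ) (Ioi 0), t ∈ Ioo 0 τ := Ioo_mem_nhdsGT hτ
  obtain ⟨δ, hδ, hall⟩ := mem_nhdsGT_iff_exists_Ioo_subset.1
    (hsin.and (hcos.and (hob.and (hb.and hτ'))))
  have hsub : ∀ t ∈ Ioo 0 δ, t ∈ Icc 0 τ := fun t ht => Ioo_subset_Icc_self (hall ht).2.2.2.2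
  refine ⟨δ, hδ, ?_⟩
  obtain ⟨μ, hμp, hμ⟩ := exists_body_adjoint hl1 hl2 hx1 hx2 he1 he2
    (fun t (_ : t ∈ Icc 0 τ) => hz t) (fun t ht => (hp t ht).2.1)
  refine tangentForm_eq_zero (α := fun t => z t 3) (μ := μ)
    (g := fun t => bodyField l1 l2 x1 x2 e1 e2 k M1 M2 β (z t 3)) isOpen_Ioo hl1.ne'
    (by positivity) (by positivity) (fun t ht => (hall ht).2.1) (fun t ht => (hall ht).2.2.1)
    (fun t ht => ?_) (fun t _ => (bodyField_rows hl1 hl2 hx1 hx2 he1 he2 k M1 M2 β _).1)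
    (fun t _ => (bodyField_rows hl1 hl2 hx1 hx2 he1 he2 k M1 M2 β _).2.1) (fun t _ => hα t)
    (fun t ht => (hμ t (hsub t ht)).1) (fun t ht => (hμ t (hsub t ht)).2.1)
    (fun t ht => (hμ t (hsub t ht)).2.2.1) (fun t ht h0 => ?_) (fun t ht => ?_)
  · by_contra! h
    have := (bodyField_rows hl1 hl2 hx1 hx2 he1 he2 k M1 M2 β (z t 3)).2.2
    rw [h.1, h.2] at this
    exact (hall ht).2.2.2.1 (by simpa using this.symm)
  · refine (hp t (hsub t ht)).1 (ContinuousLinearMap.ext fun v => ?_)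
    have h : v = Rtil (z t 2) *ᵥ (Rtil (-z t 2) *ᵥ v) := by
      have := sin_sq_add_cos_sq (z t 2)
      rw [Rtil_mulVec, Rtil_mulVec]
      ext i
      fin_cases i
      · simp
        linear_combination -v 0 * this
      · simp
        linear_combination -v 1 * this
      · simp
      · simp
    rw [h, hμp, h0]
    simp
  · obtain ⟨-, -, p1, p2⟩ := hp t (hsub t ht)
    rw [F1, X3, map_smul, hμp, smul_eq_mul] at p1
    rw [F2, X3, X4, map_sub, map_smul, map_smul, hμp, hμp, smul_eq_mul, smul_eq_mul] at p2
    have u0 := (mul_eq_zero.1 p1).resolve_left (mul_ne_zero hM1 (hall ht).1)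
    rw [u0, mul_zero, zero_sub, neg_eq_zero] at p2
    have w0 := (mul_eq_zero.1 p2).resolve_left hM2
    obtain ⟨m, hm⟩ : ∃ m, m = μ t ᵥ* (Emat l1 l2 x1 x2 e1 e2 (z t 3))⁻¹ := ⟨_, rfl⟩
    have hm2 : m 2 = 0 := by rw [hm]; exact u0
    have hm3 : m 3 = 0 := by rw [hm]; exact w0
    have hμm : μ t = m ᵥ* Emat l1 l2 x1 x2 e1 e2 (z t 3) := by
      rw [hm, Matrix.vecMul_vecMul, Matrix.nonsing_inv_mul _ (isUnit_iff_ne_zero.2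
        (Emat_det_ne_zero hl1 hl2 hx1 hx2 he1 he2 _)), Matrix.vecMul_one]
    have c0 := congrFun hμm 0
    have c1 := congrFun hμm 1
    have c2 := congrFun hμm 2
    have c3 := congrFun hμm 3
    simp [Matrix.vecMul, dotProduct, Fin.sum_univ_four, Emat, hm2, hm3] at c0 c1 c2 c3
    refine ⟨m 0, m 1, by linear_combination c0, by linear_combination c1,
      by linear_combination c2, by linear_combination c3,
      (hμ t (hsub t ht)).2.2.2.congr_deriv ?_⟩
    obtain ⟨d0, d1⟩ := bodyField_rows_deriv hl1 hl2 hx1 hx2 he1 he2 k M1 M2 β (z t 3)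
    simp only [dotProduct, Fin.sum_univ_four]
    rw [c0, c1, c2, c3]
    linear_combination -m 0 * d0 - m 1 * d1

lemma tangentForm_zero (l1 l2 p q P Q y : ℝ) :
    tangentForm l1 l2 p q P Q 0 ![0, y, 1, 0] = obstr l1 l2 p q P Q 0 ^ 2 * (P + Q) := by
  simp [tangentForm, obstr'_zero]
  ring

lemma continuous_Rtil_mulVec {f : (Fin 4 → ℝ) → Fin 4 → ℝ} (hf : Continuous f) :
    Continuous fun z : Fin 4 → ℝ => Rtil (z 2) *ᵥ f z := by
  simp only [Rtil_mulVec]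
  have h := continuous_pi_iff.1 hf
  have h0 := h 0
  have h1 := h 1
  have h2 := h 2
  have h3 := h 3
  refine continuous_pi fun i => ?_
  fin_cases i <;> simp <;> fun_prop

lemma exists_mem_Ioo_eq {f : ℝ → ℝ} {f' δ : ℝ} (hf : Continuous f) (hf0 : f 0 = 0)
    (hd : HasDerivAt f f' 0) (hf' : 0 < f') (hδ : 0 < δ) :
    ∃ η > 0, ∀ s ∈ Ioo 0 η, ∃ t ∈ Ioo 0 δ, f t = s := by
  have hpos : ∀ᶠ t in nhdsWithin (0 : ℝ) (Ioi 0), 0 < f t := by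
    have h := hd.tendsto_slope_zero_right
    filter_upwards [h.eventually (lt_mem_nhds hf'), self_mem_nhdsWithin] with t ht ht0
    simp only [zero_add, hf0, sub_zero, smul_eq_mul] at ht
    exact pos_of_mul_pos_right ht (inv_nonneg.2 (le_of_lt ht0))
  obtain ⟨t₁, h1, h2⟩ := (hpos.and (Ioo_mem_nhdsGT hδ)).exists
  refine ⟨f t₁, h1, fun s hs => ?_⟩
  obtain ⟨t, ht, rfl⟩ := intermediate_value_Ioo h2.1.le hf.continuousOn (by rwa [hf0])
  exact ⟨t, ⟨ht.1, ht.2.trans h2.2⟩, rfl⟩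

lemma angle_rate_ne_zero {l1 l2 x1 x2 e1 e2 : ℝ} (hl1 : 0 < l1) (hl2 : 0 < l2)
    (hx1 : 0 < x1) (hx2 : 0 < x2) (he1 : 0 < e1) (he2 : 0 < e2)
    {M1 M2 : ℝ}
    (hM : (3 + 4*(l2/l1) + e2*l2^2/(e1*l1^2)) * M1
      - (3 + 4*(l1/l2) + e1*l1^2/(e2*l2^2)) * M2 ≠ 0) :
    (M1 + M2) * (Emat l1 l2 x1 x2 e1 e2 0)⁻¹ 3 2 + M2 * (Emat l1 l2 x1 x2 e1 e2 0)⁻¹ 3 3 ≠ 0 := by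
  intro hK
  obtain ⟨v, hv⟩ : ∃ v, v = (Emat l1 l2 x1 x2 e1 e2 0)⁻¹ *ᵥ ![0, 0, M1 + M2, M2] := ⟨_, rfl⟩
  have hv3 : v 3 = 0 := by
    refine Eq.trans ?_ hK
    rw [hv]
    simp [Matrix.mulVec, dotProduct, Fin.sum_univ_four]
    ring
  have hE : Emat l1 l2 x1 x2 e1 e2 0 *ᵥ v = ![0, 0, M1 + M2, M2] := by
    rw [hv, Matrix.mulVec_mulVec, Matrix.mul_nonsing_inv _ (isUnit_iff_ne_zero.2
      (Emat_det_ne_zero hl1 hl2 hx1 hx2 he1 he2 0)), Matrix.one_mulVec]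
  rw [Emat_mulVec] at hE
  have h1 := congrFun hE 1
  have h2 := congrFun hE 2
  have h3 := congrFun hE 3
  simp [hv3] at h1 h2 h3
  have hS : e1*l1 + e2*l2 ≠ 0 := by positivity
  obtain ⟨r, hr⟩ : ∃ r, v 2 = 2 * (e1*l1 + e2*l2) * r :=
    ⟨v 2 / (2 * (e1*l1 + e2*l2)), by field_simp⟩
  have hr1 : v 1 = e1*l1*(l1 + l2) * r := by
    apply mul_left_cancel₀ hS
    rw [hr] at h1
    linear_combination -h1
  rw [hr, hr1] at h2 h3
  have hM2 : M2 = -(e2*l2*l2*r/6) * (3*(e1*l1*l1) + 4*(e1*l1*l2) + e2*l2*l2) := by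
    linear_combination -h3
  have hM1 : M1 = -(e1*l1*l1*r/6) * (e1*l1*l1 + e2*l2*(3*l2 + 4*l1)) := by
    linear_combination -h2 + h3
  apply hM
  rw [hM1, hM2]
  field_simp
  ring

lemma controllable_or_tangentForm_eq_zero {l1 l2 x1 x2 e1 e2 : ℝ} (hl1 : 0 < l1) (hl2 : 0 < l2)
    (hx1 : 0 < x1) (hx2 : 0 < x2) (he1 : 0 < e1) (he2 : 0 < e2)
    {k M1 M2 β : ℝ} (hβ : 0 < β)
    (hM1 : M1 ≠ 0) (hM2 : M2 ≠ 0)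
    (hobs : obstr l1 l2 (x1*l1) (x2*l2) (e1*l1) (e2*l2) 0 ≠ 0) {K : ℝ} (hK0 : K ≠ 0)
    (hK : K = (M1 + M2) * (Emat l1 l2 x1 x2 e1 e2 0)⁻¹ 3 2
      + M2 * (Emat l1 l2 x1 x2 e1 e2 0)⁻¹ 3 3) :
    (∃ zb : ℝ → Fin 4 → ℝ, zb 0 = Ovec ∧
        (∀ t ∈ Ici (0:ℝ), HasDerivWithinAt zb
          (F0 l1 l2 x1 x2 e1 e2 k (zb t) + β • F2 l1 l2 x1 x2 e1 e2 M1 M2 (zb t))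
          (Ici 0) t) ∧
        (let G : (Fin 4 → ℝ) → (Fin 4 → ℝ) :=
          fun u => F0 l1 l2 x1 x2 e1 e2 k u + β • F2 l1 l2 x1 x2 e1 e2 M1 M2 u
        let A : ℝ → Matrix (Fin 4) (Fin 4) ℝ :=
          fun t => Matrix.of fun i j => fderiv ℝ G (zb t) (Pi.single j 1) i
        ∀ τ : ℝ, 0 < τ → ∀ y0 y1 : Fin 4 → ℝ,
          ∃ v : ℝ → Fin 2 → ℝ, Measurable v ∧ (∃ C : ℝ, ∀ t, ‖v t‖ ≤ C) ∧
            ∃ y : ℝ → Fin 4 → ℝ, y 0 = y0 ∧ y τ = y1 ∧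
              ∀ t ∈ Icc (0:ℝ) τ, HasDerivWithinAt y
                ((A t).mulVec (y t)
                  + v t 0 • F1 l1 l2 x1 x2 e1 e2 M1 (zb t)
                  + v t 1 • F2 l1 l2 x1 x2 e1 e2 M1 M2 (zb t))
                (Icc 0 τ) t)) ∨
    ∃ δ > 0, ∀ s ∈ Ioo 0 δ, tangentForm l1 l2 (x1*l1) (x2*l2) (e1*l1) (e2*l2) (-(K * s))
      (bodyField l1 l2 x1 x2 e1 e2 k M1 M2 β (-(K * s))) = 0 := by
  obtain ⟨C, hC⟩ := exists_norm_drift_le hl1 hl2 hx1 hx2 he1 he2 k M1 M2 β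
  obtain ⟨z, hz0, hz⟩ := exists_global_integralCurve
    (contDiff_drift hl1 hl2 hx1 hx2 he1 he2 k M1 M2 β) hC Ovec
  have hz03 : z 0 3 = 0 := by rw [hz0]; rfl
  have hzc : Continuous z := continuous_iff_continuousAt.2 fun t => (hz t).continuousAt
  have hz1 : ContDiff ℝ 1 z := by
    refine contDiff_one_iff_deriv.2 ⟨fun t => (hz t).differentiableAt, ?_⟩
    rw [funext fun t => (hz t).deriv]
    exact (contDiff_drift hl1 hl2 hx1 hx2 he1 he2 k M1 M2 β (n := 0)).continuous.comp hzc
  have hA : ContDiff ℝ 1 fun t => fderiv ℝ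
      (fun u => F0 l1 l2 x1 x2 e1 e2 k u + β • F2 l1 l2 x1 x2 e1 e2 M1 M2 u) (z t) :=
    ((contDiff_drift hl1 hl2 hx1 hx2 he1 he2 k M1 M2 β (n := 2)).fderiv_right
      (by norm_num)).comp hz1
  have hX3 : Continuous (X3 l1 l2 x1 x2 e1 e2) :=
    continuous_Rtil_mulVec (continuous_pi fun i =>
      (contDiff_Emat_inv_apply hl1 hl2 hx1 hx2 he1 he2 (n := 0) i 2).continuous.comp
        (continuous_apply 3))
  have hX4 : Continuous (X4 l1 l2 x1 x2 e1 e2) :=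
    continuous_Rtil_mulVec (continuous_pi fun i =>
      (contDiff_Emat_inv_apply hl1 hl2 hx1 hx2 he1 he2 (n := 0) i 3).continuous.comp
        (continuous_apply 3))
  have hF1 : Continuous fun t => F1 l1 l2 x1 x2 e1 e2 M1 (z t) := by
    unfold F1
    fun_prop
  have hF2 : Continuous fun t => F2 l1 l2 x1 x2 e1 e2 M1 M2 (z t) := by
    unfold F2
    fun_prop
  by_cases hcon : ∀ τ : ℝ, 0 < τ → ∀ y0 y1 : Fin 4 → ℝ,
      ∃ v : ℝ → Fin 2 → ℝ, Measurable v ∧ (∃ C : ℝ, ∀ t, ‖v t‖ ≤ C) ∧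
        ∃ y : ℝ → Fin 4 → ℝ, y 0 = y0 ∧ y τ = y1 ∧
          ∀ t ∈ Icc (0:ℝ) τ, HasDerivWithinAt y
            (fderiv ℝ (fun u => F0 l1 l2 x1 x2 e1 e2 k u + β • F2 l1 l2 x1 x2 e1 e2 M1 M2 u)
                (z t) (y t)
              + v t 0 • F1 l1 l2 x1 x2 e1 e2 M1 (z t)
              + v t 1 • F2 l1 l2 x1 x2 e1 e2 M1 M2 (z t))
            (Icc 0 τ) t
  · refine Or.inl ⟨z, hz0, fun t _ => (hz t).hasDerivWithinAt, ?_⟩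
    intro G A τ hτ y0 y1
    obtain ⟨v, hv, hvC, y, hy0, hy1, hy⟩ := hcon τ hτ y0 y1
    refine ⟨v, hv, hvC, y, hy0, hy1, fun t ht => ?_⟩
    have hAG : A t *ᵥ y t = fderiv ℝ G (z t) (y t) := by
      have : A t = LinearMap.toMatrix' (fderiv ℝ G (z t)).toLinearMap := by
        ext i j
        simp [A, LinearMap.toMatrix'_apply]
      rw [this, LinearMap.toMatrix'_mulVec]
      rfl
    rw [hAG]
    exact hy t ht
  · push Not at hcon
    obtain ⟨τ, hτ, y0, y1, hno⟩ := hcon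
    right
    rcases controllable_or_exists_adjoint hA hF1 hF2 hτ with h | ⟨p, hp⟩
    · obtain ⟨v, hv, ⟨C, hvC⟩, y, hy0, hy1, hy⟩ := h y0 y1
      obtain ⟨t, ht, hn⟩ := hno v hv ⟨C, hvC⟩ y hy0 hy1
      exact absurd (hy t ht) hn
    · have hrate : bodyField l1 l2 x1 x2 e1 e2 k M1 M2 β 0 3 = -(β * K) := by
        rw [bodyField_eq, hK]
        simp
        ring
      obtain ⟨δ, hδ, h⟩ := eventually_tangentForm_eq_zero hl1 hl2 hx1 hx2 he1 he2 hβ hM1 hM2 hτ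
        hz03 hz hp hobs (by rw [hrate]; simp [hβ.ne', hK0])
      have hd : HasDerivAt (fun t => -(z t 3) / K) β 0 := by
        have := hasDerivAt_pi.1 (hz 0) 3
        rw [drift_eq, Rtil_mulVec, hz03] at this
        simp only [Matrix.cons_val, hrate] at this
        refine (this.neg.div_const K).congr_deriv ?_
        field_simp
      obtain ⟨η, hη, hs⟩ := exists_mem_Ioo_eq (by fun_prop) (by simp [hz03]) hd hβ hδ
      refine ⟨η, hη, fun s hs' => ?_⟩
      obtain ⟨t, ht, hts⟩ := hs s hs'
      have : -(K * s) = z t 3 := by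
        rw [← hts]
        field_simp
      rw [this]
      exact h t ht

lemma eventually_mul_cos_add_ne_zero {M1 M2 K : ℝ} (hM1 : M1 ≠ 0) (hK : K ≠ 0) :
    ∀ᶠ s in nhdsWithin (0 : ℝ) (Ioi 0), M1 * cos (-(K * s)) + M2 ≠ 0 := by
  have hc : Continuous fun s : ℝ => M1 * cos (-(K * s)) + M2 := by fun_prop
  by_cases h : M1 + M2 = 0
  · have hK' : Continuous fun s : ℝ => |K * s| := by fun_prop
    have hlt : ∀ᶠ s in nhds (0 : ℝ), |K * s| < 2 * π :=
      (hK'.tendsto 0).eventually (gt_mem_nhds (by simp [pi_pos]))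
    filter_upwards [hlt.filter_mono nhdsWithin_le_nhds, self_mem_nhdsWithin] with s hs hs0 h0
    have h1 : M1 * (cos (-(K * s)) - 1) = 0 := by linear_combination h0 - h
    have h2 := (mul_eq_zero.1 h1).resolve_left hM1
    rw [cos_neg, sub_eq_zero, cos_eq_one_iff_of_lt_of_lt (abs_lt.1 hs).1 (abs_lt.1 hs).2] at h2
    exact mul_ne_zero hK (ne_of_gt hs0) h2
  · exact ((hc.tendsto 0).eventually_ne (by simpa using h)).filter_mono nhdsWithin_le_nhds

lemma eq_zero_of_eventually_right {f : ℝ → ℝ} {K : ℝ} (hf : Continuous f)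
    (h : ∀ᶠ s in nhdsWithin (0 : ℝ) (Ioi 0), f (-(K * s)) = 0) : f 0 = 0 := by
  have hc : Continuous fun s => f (-(K * s)) := by fun_prop
  have h1 := (hc.tendsto 0).mono_left (nhdsWithin_le_nhds (s := Ioi 0))
  simp only [mul_zero, neg_zero] at h1
  exact tendsto_nhds_unique h1 (tendsto_const_nhds.congr' (h.mono fun s hs => hs.symm))

lemma tangentForm_bodyField_incompatible {l1 l2 x1 x2 e1 e2 : ℝ} (hl1 : 0 < l1) (hl2 : 0 < l2)
    (hx1 : 0 < x1) (hx2 : 0 < x2) (he1 : 0 < e1) (he2 : 0 < e2) {k M1 M2 K β β' : ℝ}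
    (hk : k ≠ 0) (hM1 : M1 ≠ 0) (hK : K ≠ 0) (hβ : β ≠ 0) (hββ' : β ≠ β')
    (hobs : obstr l1 l2 (x1*l1) (x2*l2) (e1*l1) (e2*l2) 0 ≠ 0)
    (h : ∃ δ > 0, ∀ s ∈ Ioo 0 δ, tangentForm l1 l2 (x1*l1) (x2*l2) (e1*l1) (e2*l2) (-(K * s))
      (bodyField l1 l2 x1 x2 e1 e2 k M1 M2 β (-(K * s))) = 0)
    (h' : ∃ δ > 0, ∀ s ∈ Ioo 0 δ, tangentForm l1 l2 (x1*l1) (x2*l2) (e1*l1) (e2*l2) (-(K * s))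
      (bodyField l1 l2 x1 x2 e1 e2 k M1 M2 β' (-(K * s))) = 0) : False := by
  obtain ⟨δ, hδ, h⟩ := h
  obtain ⟨δ', hδ', h'⟩ := h'
  obtain ⟨φ, hφ⟩ : ∃ φ : Fin 4 → ℝ → ℝ, φ = fun j a =>
    tangentForm l1 l2 (x1*l1) (x2*l2) (e1*l1) (e2*l2) a
      (fun i => (Emat l1 l2 x1 x2 e1 e2 a)⁻¹ i j) := ⟨_, rfl⟩
  have hφc : ∀ j, Continuous (φ j) := fun j => by
    rw [hφ]
    exact continuous_tangentForm _ _ _ _ _ _ fun i =>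
      (contDiff_Emat_inv_apply hl1 hl2 hx1 hx2 he1 he2 (n := 0) i j).continuous
  have hsplit : ∀ β a, tangentForm l1 l2 (x1*l1) (x2*l2) (e1*l1) (e2*l2) a
      (bodyField l1 l2 x1 x2 e1 e2 k M1 M2 β a) =
      -(β * (M1 * cos a + M2)) * φ 2 a + (k * a - β * M2) * φ 3 a := fun β a => by
    rw [bodyField_eq, tangentForm_add, tangentForm_smul, tangentForm_smul, hφ]
  have hev : ∀ᶠ s in nhdsWithin (0 : ℝ) (Ioi 0), φ 2 (-(K * s)) = 0 ∧ φ 3 (-(K * s)) = 0 := by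
    filter_upwards [Ioo_mem_nhdsGT hδ, Ioo_mem_nhdsGT hδ',
      eventually_mul_cos_add_ne_zero (M2 := M2) hM1 hK] with s hs hs' hne
    have e1 := h s hs
    have e2 := h' s hs'
    rw [hsplit] at e1 e2
    have e3 : k * (K * s) * (β - β') * φ 3 (-(K * s)) = 0 := by
      linear_combination β' * e1 - β * e2
    have hs0 : s ≠ 0 := hs.1.ne'
    have z3 : φ 3 (-(K * s)) = 0 := (mul_eq_zero.1 e3).resolve_left
      (mul_ne_zero (mul_ne_zero hk (mul_ne_zero hK hs0)) (sub_ne_zero.2 hββ'))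
    rw [z3, mul_zero, add_zero] at e1
    exact ⟨(mul_eq_zero.1 e1).resolve_left (neg_ne_zero.2 (mul_ne_zero hβ hne)), z3⟩
  have z2 := eq_zero_of_eventually_right (hφc 2) (hev.mono fun s hs => hs.1)
  have z3 := eq_zero_of_eventually_right (hφc 3) (hev.mono fun s hs => hs.2)
  obtain ⟨y, hy⟩ : ∃ y, y = e1*l1*(l1 + l2) / (2 * (e1*l1 + e2*l2)) := ⟨_, rfl⟩
  have hS : 0 < e1*l1 + e2*l2 := by positivity
  obtain ⟨v, hv⟩ : ∃ v : Fin 4 → ℝ, v = ![0, y, 1, 0] := ⟨_, rfl⟩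
  obtain ⟨w, hw⟩ : ∃ w, w = Emat l1 l2 x1 x2 e1 e2 0 *ᵥ v := ⟨_, rfl⟩
  have hw0 : w 0 = 0 := by
    rw [hw, Emat_mulVec, hv]
    simp
  have hw1 : w 1 = 0 := by
    rw [hw, Emat_mulVec, hv]
    simp [hy]
    field_simp
    ring
  have hvw : v = w 2 • (fun i => (Emat l1 l2 x1 x2 e1 e2 0)⁻¹ i 2)
      + w 3 • (fun i => (Emat l1 l2 x1 x2 e1 e2 0)⁻¹ i 3) := by
    have : v = (Emat l1 l2 x1 x2 e1 e2 0)⁻¹ *ᵥ w := by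
      rw [hw, Matrix.mulVec_mulVec, Matrix.nonsing_inv_mul _ (isUnit_iff_ne_zero.2
        (Emat_det_ne_zero hl1 hl2 hx1 hx2 he1 he2 0)), Matrix.one_mulVec]
    rw [this]
    ext i
    simp [Matrix.mulVec, dotProduct, Fin.sum_univ_four, hw0, hw1, mul_comm]
  have hT : tangentForm l1 l2 (x1*l1) (x2*l2) (e1*l1) (e2*l2) 0 v = 0 := by
    simp only [hφ] at z2 z3
    rw [hvw, tangentForm_add, tangentForm_smul, tangentForm_smul, z2, z3]
    ring
  rw [hv, tangentForm_zero] at hT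
  exact mul_ne_zero (pow_ne_zero 2 hobs) hS.ne' hT

/-- Linear controllability along the reference trajectories,
Lemma 2 of the paper. -/
theorem stmt_14 (l1 l2 x1 x2 e1 e2 k M1 M2 : ℝ)
    (hl1 : 0 < l1) (hl2 : 0 < l2) (hx1 : 0 < x1) (hx2 : 0 < x2)
    (he1 : 0 < e1) (he2 : 0 < e2) (hk : 0 < k)
    (hA : AssumptionA l1 l2 x1 x2 e1 e2 M1 M2) :
    ∀ ε : ℝ, 0 < ε → ∃ β : ℝ, 0 < β ∧ β < ε ∧
      ∃ zb : ℝ → Fin 4 → ℝ, zb 0 = Ovec ∧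
        (∀ t ∈ Ici (0:ℝ), HasDerivWithinAt zb
          (F0 l1 l2 x1 x2 e1 e2 k (zb t) + β • F2 l1 l2 x1 x2 e1 e2 M1 M2 (zb t))
          (Ici 0) t) ∧
        (let G : (Fin 4 → ℝ) → (Fin 4 → ℝ) :=
          fun u => F0 l1 l2 x1 x2 e1 e2 k u + β • F2 l1 l2 x1 x2 e1 e2 M1 M2 u
        let A : ℝ → Matrix (Fin 4) (Fin 4) ℝ :=
          fun t => Matrix.of fun i j => fderiv ℝ G (zb t) (Pi.single j 1) i
        ∀ τ : ℝ, 0 < τ → ∀ y0 y1 : Fin 4 → ℝ,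
          ∃ v : ℝ → Fin 2 → ℝ, Measurable v ∧ (∃ C : ℝ, ∀ t, ‖v t‖ ≤ C) ∧
            ∃ y : ℝ → Fin 4 → ℝ, y 0 = y0 ∧ y τ = y1 ∧
              ∀ t ∈ Icc (0:ℝ) τ, HasDerivWithinAt y
                ((A t).mulVec (y t)
                  + v t 0 • F1 l1 l2 x1 x2 e1 e2 M1 (zb t)
                  + v t 1 • F2 l1 l2 x1 x2 e1 e2 M1 M2 (zb t))
                (Icc 0 τ) t) := by
  intro ε hε
  obtain ⟨hne, h1, h2, hM1, hM2, hM⟩ := hA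
  have hobs : obstr l1 l2 (x1*l1) (x2*l2) (e1*l1) (e2*l2) 0 ≠ 0 := by
    rw [obstr_zero hl1.ne' (by positivity)]
    refine mul_ne_zero (neg_ne_zero.2 (by positivity)) ?_
    have hpos : 0 < e1 - x1 ∨ 0 < e2 - x2 := by
      by_contra! h
      exact hne (by rw [show e1 - x1 = 0 by linarith, show e2 - x2 = 0 by linarith])
    have h1' := sub_nonneg.2 h1
    have h2' := sub_nonneg.2 h2
    have e : e1*l1*l1*(e2*l2 - x2*l2) + e2*l2*l2*(e1*l1 - x1*l1) =
        e1*l1*l1*l2*(e2 - x2) + e2*l2*l2*l1*(e1 - x1) := by ring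
    rw [e]
    rcases hpos with h | h <;> positivity
  have hK := angle_rate_ne_zero hl1 hl2 hx1 hx2 he1 he2 hM
  rcases controllable_or_tangentForm_eq_zero hl1 hl2 hx1 hx2 he1 he2 (k := k)
    (half_pos hε) hM1 hM2 hobs hK rfl with h | h
  · exact ⟨ε / 2, half_pos hε, half_lt_self hε, h⟩
  rcases controllable_or_tangentForm_eq_zero hl1 hl2 hx1 hx2 he1 he2 (k := k)
    (show 0 < ε / 3 by positivity) hM1 hM2 hobs hK rfl with h' | h'
  · exact ⟨ε / 3, by positivity, by linarith, h'⟩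
  exact (tangentForm_bodyField_incompatible hl1 hl2 hx1 hx2 he1 he2 hk.ne' hM1 hK
    (by positivity) (by intro h; linarith) hobs h h').elim
end
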